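/- arXiv:2212.01068 — 12 statements merged into one kernel-verified Lean document; each statement's English description precedes it below -/
import Mathlib

section
/- A point h ∈ H satisfies: there exists θ ≥ 0 with ‖x − θ·φ(h)‖ ≤ ε, if and only if h ∈ K(ε). Moreover, for every h ∈ K(ε), the minimum min{θ ≥ 0 : ‖x − θ·φ(h)‖ ≤ ε} exists and equals η(h) = (‖x‖² − ε²)/(⟨x, φ(h)⟩ + ‖φ(h)‖·√(ε² − e(h))). -/
open scoped RealInnerProductSpace

noncomputable section

/- The function `e(h) = min_θ ‖x - θ·φ(h)‖²`. -/
open Classical in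
def eFun {H : Type*} [NormedAddCommGroup H] [InnerProductSpace ℝ H] {n : ℕ}
    (φ : H →ₗ[ℝ] EuclideanSpace ℝ (Fin n)) (x : EuclideanSpace ℝ (Fin n)) (h : H) : ℝ :=
  if φ h = 0 then ‖x‖ ^ 2 else ‖x‖ ^ 2 - (⟪x, φ h⟫) ^ 2 / ‖φ h‖ ^ 2

/- The convex cone `K(ε̄) = {h : ⟨x, φ h⟩ > 0 and e(h) ≤ ε̄²}`. -/
def Kcone {H : Type*} [NormedAddCommGroup H] [InnerProductSpace ℝ H] {n : ℕ}
    (φ : H →ₗ[ℝ] EuclideanSpace ℝ (Fin n)) (x : EuclideanSpace ℝ (Fin n)) (ebar : ℝ) :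
    Set H :=
  {h | 0 < ⟪x, φ h⟫ ∧ eFun φ x h ≤ ebar ^ 2}

/- The objective `η(h) = (‖x‖² - ε²)/(⟨x, φ h⟩ + ‖φ h‖·√(ε² - e(h)))`. -/
def etaFun {H : Type*} [NormedAddCommGroup H] [InnerProductSpace ℝ H] {n : ℕ}
    (φ : H →ₗ[ℝ] EuclideanSpace ℝ (Fin n)) (x : EuclideanSpace ℝ (Fin n)) (ε : ℝ)
    (h : H) : ℝ :=
  (‖x‖ ^ 2 - ε ^ 2) / (⟪x, φ h⟫ + ‖φ h‖ * Real.sqrt (ε ^ 2 - eFun φ x h))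

theorem norm_sub_smul_le_iff {V : Type*} [NormedAddCommGroup V] [InnerProductSpace ℝ V]
    (x v : V) (θ : ℝ) {ε : ℝ} (hε : 0 ≤ ε) :
    ‖x - θ • v‖ ≤ ε ↔ ‖x‖ ^ 2 - ε ^ 2 - 2 * θ * ⟪x, v⟫ + θ ^ 2 * ‖v‖ ^ 2 ≤ 0 := by
  rw [← sq_le_sq₀ (norm_nonneg _) hε, norm_sub_sq_real, inner_smul_right, norm_smul, mul_pow,
    Real.norm_eq_abs, sq_abs]
  constructor <;> intro h <;> linarith

theorem isLeast_quadratic_nonpos {a b c s : ℝ} (ha : 0 < a) (hb : 0 < b) (hc : 0 < c)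
    (hs : 0 ≤ s) (hsq : s ^ 2 = a ^ 2 - b ^ 2 * c) :
    IsLeast {θ : ℝ | 0 ≤ θ ∧ c - 2 * θ * a + θ ^ 2 * b ^ 2 ≤ 0} (c / (a + s)) := by
  have has : 0 < a + s := by linarith
  refine ⟨⟨by positivity, le_of_eq ?_⟩, fun θ ⟨_, hθ⟩ => ?_⟩
  · field_simp
    linear_combination c * hsq
  · rw [div_le_iff₀ has]
    have hb2 : 0 < b ^ 2 := by positivity
    have hle : (a - θ * b ^ 2) ^ 2 ≤ s ^ 2 := by
      nlinarith [mul_nonpos_of_nonneg_of_nonpos hb2.le hθ]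
    have hroot : a - θ * b ^ 2 ≤ s := (abs_le_of_sq_le_sq' hle hs).2
    refine le_of_mul_le_mul_left ?_ hb2
    nlinarith [mul_nonneg has.le (sub_nonneg.2 hroot)]

/- STATEMENT 1: feasibility of scaling iff membership in `K(ε)`, and the minimal
scaling equals `η(h)`. -/
theorem stmt1 {H : Type*} [NormedAddCommGroup H] [InnerProductSpace ℝ H]
    [FiniteDimensional ℝ H] {n : ℕ}
    (φ : H →ₗ[ℝ] EuclideanSpace ℝ (Fin n)) (x : EuclideanSpace ℝ (Fin n))
    (ε : ℝ) (hε : 0 < ε) (hx : ε < ‖x‖) :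
    (∀ h : H, (∃ θ : ℝ, 0 ≤ θ ∧ ‖x - θ • φ h‖ ≤ ε) ↔ h ∈ Kcone φ x ε) ∧
    (∀ h ∈ Kcone φ x ε,
      IsLeast {θ : ℝ | 0 ≤ θ ∧ ‖x - θ • φ h‖ ≤ ε} (etaFun φ x ε h)) := by
  have hc : 0 < ‖x‖ ^ 2 - ε ^ 2 := by nlinarith
  have hleast : ∀ h ∈ Kcone φ x ε,
      IsLeast {θ : ℝ | 0 ≤ θ ∧ ‖x - θ • φ h‖ ≤ ε} (etaFun φ x ε h) := by
    rintro h ⟨ha, he⟩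
    have hv : φ h ≠ 0 := by
      intro h0
      simp [h0] at ha
    have hb : 0 < ‖φ h‖ := norm_pos_iff.2 hv
    have hsq : (‖φ h‖ * √(ε ^ 2 - eFun φ x h)) ^ 2 =
        ⟪x, φ h⟫ ^ 2 - ‖φ h‖ ^ 2 * (‖x‖ ^ 2 - ε ^ 2) := by
      rw [mul_pow, Real.sq_sqrt (sub_nonneg.2 he), eFun, if_neg hv]
      field_simp
      ring
    simpa only [norm_sub_smul_le_iff x (φ h) _ hε.le, etaFun] using
      isLeast_quadratic_nonpos ha hb hc (by positivity) hsq
  refine ⟨fun h => ⟨?_, fun hh => ⟨_, (hleast h hh).1⟩⟩, hleast⟩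
  rintro ⟨θ, hθ, hle⟩
  rw [norm_sub_smul_le_iff x (φ h) θ hε.le] at hle
  have ha : 0 < ⟪x, φ h⟫ := by
    refine pos_of_mul_pos_right (a := θ) ?_ hθ
    nlinarith [sq_nonneg (θ * ‖φ h‖)]
  have hv : φ h ≠ 0 := by
    intro h0
    simp [h0] at ha
  have hb : 0 < ‖φ h‖ ^ 2 := by positivity
  refine ⟨ha, ?_⟩
  rw [eFun, if_neg hv, sub_le_comm, le_div_iff₀ hb]
  nlinarith [mul_nonpos_of_nonneg_of_nonpos hb.le hle, sq_nonneg (⟪x, φ h⟫ - θ * ‖φ h‖ ^ 2)]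
end
end

section
/- The function η : K(ε) → [0, ∞) defined by η(h) = (‖x‖² − ε²)/(⟨x, φ(h)⟩ + ‖φ(h)‖·√(ε² − e(h))) is convex on the convex cone K(ε). -/
open scoped RealInnerProductSpace

noncomputable section

/-- Reverse Minkowski inequality for the Lorentzian form `⟪x, y⟫² - c‖y‖²`. -/
theorem sq_sqrt_add_sqrt_le {E : Type*} [NormedAddCommGroup E] [InnerProductSpace ℝ E]
    {x y z : E} {c : ℝ} (hc : 0 ≤ c) (hy : 0 ≤ ⟪x, y⟫) (hz : 0 ≤ ⟪x, z⟫)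
    (hy' : c * ‖y‖ ^ 2 ≤ ⟪x, y⟫ ^ 2) (hz' : c * ‖z‖ ^ 2 ≤ ⟪x, z⟫ ^ 2) :
    (√(⟪x, y⟫ ^ 2 - c * ‖y‖ ^ 2) + √(⟪x, z⟫ ^ 2 - c * ‖z‖ ^ 2)) ^ 2 ≤
      ⟪x, y + z⟫ ^ 2 - c * ‖y + z‖ ^ 2 := by
  have hyz : c * ⟪y, z⟫ ≤ c * (‖y‖ * ‖z‖) :=
    mul_le_mul_of_nonneg_left (real_inner_le_norm y z) hc
  rw [norm_add_sq_real, inner_add_right]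
  generalize ⟪x, y⟫ = a at *
  generalize ⟪x, z⟫ = b at *
  have hs := Real.sq_sqrt (sub_nonneg.2 hy')
  have ht := Real.sq_sqrt (sub_nonneg.2 hz')
  have hcn : c * (‖y‖ * ‖z‖) ≤ a * b := by
    refine abs_le_of_sq_le_sq' ?_ (mul_nonneg hy hz) |>.2
    calc (c * (‖y‖ * ‖z‖)) ^ 2 = (c * ‖y‖ ^ 2) * (c * ‖z‖ ^ 2) := by ring
      _ ≤ a ^ 2 * b ^ 2 := by gcongr
      _ = (a * b) ^ 2 := by ring
  have hst : √(a ^ 2 - c * ‖y‖ ^ 2) * √(b ^ 2 - c * ‖z‖ ^ 2) ≤ a * b - c * (‖y‖ * ‖z‖) := by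
    refine abs_le_of_sq_le_sq' ?_ (sub_nonneg.2 hcn) |>.2
    rw [mul_pow, hs, ht]
    linarith [mul_nonneg hc (sq_nonneg (a * ‖z‖ - b * ‖y‖))]
  linarith

section

variable {H : Type*} [NormedAddCommGroup H] [InnerProductSpace ℝ H] {n : ℕ}
  {φ : H →ₗ[ℝ] EuclideanSpace ℝ (Fin n)} {x : EuclideanSpace ℝ (Fin n)} {ε : ℝ} {h : H}

theorem norm_sq_mul_sub_eFun (hh : φ h ≠ 0) :
    ‖φ h‖ ^ 2 * (ε ^ 2 - eFun φ x h) = ⟪x, φ h⟫ ^ 2 - (‖x‖ ^ 2 - ε ^ 2) * ‖φ h‖ ^ 2 := by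
  have : ‖φ h‖ ≠ 0 := norm_ne_zero_iff.2 hh
  rw [eFun, if_neg hh]
  field_simp
  ring

theorem ne_zero_of_inner_pos (hh : 0 < ⟪x, φ h⟫) : φ h ≠ 0 := by
  intro h0
  simp [h0] at hh

theorem mem_Kcone_iff :
    h ∈ Kcone φ x ε ↔
      0 < ⟪x, φ h⟫ ∧ (‖x‖ ^ 2 - ε ^ 2) * ‖φ h‖ ^ 2 ≤ ⟪x, φ h⟫ ^ 2 := by
  refine and_congr_right fun hh ↦ ?_
  have h0 := ne_zero_of_inner_pos hh
  have hpos : 0 < ‖φ h‖ ^ 2 := by positivity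
  rw [← sub_nonneg, ← mul_nonneg_iff_of_pos_left hpos, norm_sq_mul_sub_eFun h0, sub_nonneg]

theorem etaFun_eq (hh : φ h ≠ 0) :
    etaFun φ x ε h = (‖x‖ ^ 2 - ε ^ 2) /
      (⟪x, φ h⟫ + √(⟪x, φ h⟫ ^ 2 - (‖x‖ ^ 2 - ε ^ 2) * ‖φ h‖ ^ 2)) := by
  rw [etaFun, ← norm_sq_mul_sub_eFun hh, Real.sqrt_mul (sq_nonneg _),
    Real.sqrt_sq (norm_nonneg _)]

end

/- STATEMENT 2: `η` is convex on the convex cone `K(ε)`. -/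
theorem stmt2 {H : Type*} [NormedAddCommGroup H] [InnerProductSpace ℝ H]
    [FiniteDimensional ℝ H] {n : ℕ}
    (φ : H →ₗ[ℝ] EuclideanSpace ℝ (Fin n)) (x : EuclideanSpace ℝ (Fin n))
    (ε : ℝ) (hε : 0 < ε) (hx : ε < ‖x‖) :
    ConvexOn ℝ (Kcone φ x ε) (etaFun φ x ε) := by
  have hc : 0 < ‖x‖ ^ 2 - ε ^ 2 := by nlinarith
  have key : ∀ ⦃u⦄, u ∈ Kcone φ x ε → ∀ ⦃v⦄, v ∈ Kcone φ x ε → ∀ ⦃s t : ℝ⦄, 0 ≤ s → 0 ≤ t →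
      s + t = 1 → s • u + t • v ∈ Kcone φ x ε ∧
      s * √(⟪x, φ u⟫ ^ 2 - (‖x‖ ^ 2 - ε ^ 2) * ‖φ u‖ ^ 2) +
        t * √(⟪x, φ v⟫ ^ 2 - (‖x‖ ^ 2 - ε ^ 2) * ‖φ v‖ ^ 2) ≤
      √(⟪x, φ (s • u + t • v)⟫ ^ 2 - (‖x‖ ^ 2 - ε ^ 2) * ‖φ (s • u + t • v)‖ ^ 2) := by
    intro u hu v hv s t hs ht hst
    rw [mem_Kcone_iff] at hu hv ⊢
    have hscale : ∀ (r : ℝ) (w : H),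
        ⟪x, r • φ w⟫ ^ 2 - (‖x‖ ^ 2 - ε ^ 2) * ‖r • φ w‖ ^ 2 =
          r ^ 2 * (⟪x, φ w⟫ ^ 2 - (‖x‖ ^ 2 - ε ^ 2) * ‖φ w‖ ^ 2) := by
      intro r w
      rw [real_inner_smul_right, norm_smul, mul_pow ‖r‖, Real.norm_eq_abs, sq_abs]
      ring
    have hcone : ∀ {r : ℝ} {w : H}, (‖x‖ ^ 2 - ε ^ 2) * ‖φ w‖ ^ 2 ≤ ⟪x, φ w⟫ ^ 2 →
        (‖x‖ ^ 2 - ε ^ 2) * ‖r • φ w‖ ^ 2 ≤ ⟪x, r • φ w⟫ ^ 2 := by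
      intro r w hw
      rw [← sub_nonneg, hscale]
      exact mul_nonneg (sq_nonneg r) (sub_nonneg.2 hw)
    have hsqrt := sq_sqrt_add_sqrt_le (x := x) (y := s • φ u) (z := t • φ v) hc.le
      (by rw [real_inner_smul_right]; exact mul_nonneg hs hu.1.le)
      (by rw [real_inner_smul_right]; exact mul_nonneg ht hv.1.le)
      (hcone hu.2) (hcone hv.2)
    rw [hscale, hscale, Real.sqrt_mul (sq_nonneg s), Real.sqrt_mul (sq_nonneg t),
      Real.sqrt_sq hs, Real.sqrt_sq ht] at hsqrt
    rw [map_add, map_smul, map_smul]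
    refine ⟨⟨?_, sub_nonneg.1 ((sq_nonneg _).trans hsqrt)⟩, Real.le_sqrt_of_sq_le hsqrt⟩
    rw [inner_add_right, real_inner_smul_right, real_inner_smul_right]
    exact convex_Ioi (0 : ℝ) hu.1 hv.1 hs ht hst
  refine ⟨fun u hu v hv s t hs ht hst ↦ (key hu hv hs ht hst).1, ?_⟩
  intro u hu v hv s t hs ht hst
  obtain ⟨hw, hle⟩ := key hu hv hs ht hst
  rw [etaFun_eq (ne_zero_of_inner_pos hu.1), etaFun_eq (ne_zero_of_inner_pos hv.1),
    etaFun_eq (ne_zero_of_inner_pos hw.1)]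
  have hD : ∀ {w : H}, w ∈ Kcone φ x ε →
      0 < ⟪x, φ w⟫ + √(⟪x, φ w⟫ ^ 2 - (‖x‖ ^ 2 - ε ^ 2) * ‖φ w‖ ^ 2) :=
    fun hw ↦ add_pos_of_pos_of_nonneg hw.1 (Real.sqrt_nonneg _)
  have hinner : ⟪x, φ (s • u + t • v)⟫ = s * ⟪x, φ u⟫ + t * ⟪x, φ v⟫ := by
    simp [inner_add_right, real_inner_smul_right]
  have hDu := hD hu
  have hDv := hD hv
  have hinv := (convexOn_zpow (𝕜 := ℝ) (-1)).2 hDu hDv hs ht hst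
  have hpos := convex_Ioi (0 : ℝ) hDu hDv hs ht hst
  simp only [zpow_neg_one, smul_eq_mul, Set.mem_Ioi] at hinv hpos ⊢
  calc _ ≤ (‖x‖ ^ 2 - ε ^ 2) / _ :=
        div_le_div_of_nonneg_left hc.le hpos (by linarith)
    _ ≤ _ := by
      rw [div_eq_mul_inv]
      exact (mul_le_mul_of_nonneg_left hinv hc.le).trans_eq (by ring)
end
end

section
/- Let c* be the optimal value of the LIP and let f* be an optimal solution. For any ε̄ ∈ (0, ε) with e(f*) ≤ ε̄² and any η̂ > c*, let Ĥ(ε̄, η̂) = {h ∈ B_c ∩ K(ε̄) : η(h) ≤ η̂}. Then η : Ĥ(ε̄, η̂) → [0, ∞) is β-smooth with β = (ε²·η̂³ / (ε² − ε̄²)^{3/2}) · ((‖x‖ + ε)/(‖x‖ − ε)²) · λ̂(φᵃ∘φ), where λ̂(φᵃ∘φ) is the maximum eigenvalue of φᵃ∘φ; that is, ‖∇η(h) − ∇η(h')‖ ≤ β·‖h − h'‖ for all h, h' ∈ Ĥ(ε̄, η̂). -/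
open scoped RealInnerProductSpace

noncomputable section

section ObliqueProjection

variable {F : Type*} [NormedAddCommGroup F] [InnerProductSpace ℝ F]

/-- The oblique projection along `v` onto the orthogonal complement of `u` has norm at most
`‖u‖ * ‖v‖ / ⟪u, v⟫`. -/
lemma norm_sub_smul_le_of_inner_pos (u v d : F) (huv : 0 < ⟪u, v⟫) :
    ‖d - (⟪u, d⟫ / ⟪u, v⟫) • v‖ ≤ ‖u‖ * ‖v‖ / ⟪u, v⟫ * ‖d‖ := by
  have hv : v ≠ 0 := by
    rintro rfl
    simp at huv
  have hq : 0 < ‖v‖ ^ 2 := by positivity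
  have hcs := real_inner_mul_inner_self_le
    ((‖v‖ ^ 2) • u - ⟪u, v⟫ • v) ((‖v‖ ^ 2) • d - ⟪v, d⟫ • v)
  have e1 : ⟪(‖v‖ ^ 2) • u - ⟪u, v⟫ • v, (‖v‖ ^ 2) • d - ⟪v, d⟫ • v⟫
      = ‖v‖ ^ 2 * (‖v‖ ^ 2 * ⟪u, d⟫ - ⟪u, v⟫ * ⟪v, d⟫) := by
    simp only [inner_sub_left, inner_sub_right, inner_smul_left, inner_smul_right,
      real_inner_self_eq_norm_sq, RCLike.conj_to_real]
    ring
  have e2 : ⟪(‖v‖ ^ 2) • u - ⟪u, v⟫ • v, (‖v‖ ^ 2) • u - ⟪u, v⟫ • v⟫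
      = ‖v‖ ^ 2 * (‖v‖ ^ 2 * ‖u‖ ^ 2 - ⟪u, v⟫ ^ 2) := by
    simp only [inner_sub_left, inner_sub_right, inner_smul_left, inner_smul_right,
      real_inner_self_eq_norm_sq, RCLike.conj_to_real, real_inner_comm u v]
    ring
  have e3 : ⟪(‖v‖ ^ 2) • d - ⟪v, d⟫ • v, (‖v‖ ^ 2) • d - ⟪v, d⟫ • v⟫
      = ‖v‖ ^ 2 * (‖v‖ ^ 2 * ‖d‖ ^ 2 - ⟪v, d⟫ ^ 2) := by
    simp only [inner_sub_left, inner_sub_right, inner_smul_left, inner_smul_right,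
      real_inner_self_eq_norm_sq, RCLike.conj_to_real, real_inner_comm v d]
    ring
  have e4 : ‖d - (⟪u, d⟫ / ⟪u, v⟫) • v‖ ^ 2
      = ‖d‖ ^ 2 - 2 * (⟪u, d⟫ / ⟪u, v⟫) * ⟪v, d⟫ + (⟪u, d⟫ / ⟪u, v⟫) ^ 2 * ‖v‖ ^ 2 := by
    rw [norm_sub_sq_real, inner_smul_right, norm_smul, mul_pow, Real.norm_eq_abs, sq_abs,
      real_inner_comm v d]
    ring
  rw [e1, e2, e3] at hcs
  refine le_of_sq_le_sq ?_ (by positivity)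
  rw [e4]
  generalize ⟪u, v⟫ = r at *
  generalize ⟪u, d⟫ = p at *
  generalize ⟪v, d⟫ = m at *
  generalize ‖v‖ = V at *
  generalize ‖u‖ = U at *
  generalize ‖d‖ = D at *
  have h5 : V ^ 2 * V ^ 2 * V ^ 2 * (r ^ 2 * D ^ 2 - 2 * p * r * m + p ^ 2 * V ^ 2)
      ≤ V ^ 2 * V ^ 2 * V ^ 2 * (U ^ 2 * V ^ 2 * D ^ 2 - m ^ 2 * U ^ 2) := by
    nlinarith [hcs]
  have h6 := le_of_mul_le_mul_left h5 (by positivity)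
  have h7 : r ^ 2 * D ^ 2 - 2 * p * r * m + p ^ 2 * V ^ 2 ≤ U ^ 2 * V ^ 2 * D ^ 2 := by
    nlinarith [sq_nonneg (m * U)]
  have h8 : D ^ 2 - 2 * (p / r) * m + (p / r) ^ 2 * V ^ 2
      = (r ^ 2 * D ^ 2 - 2 * p * r * m + p ^ 2 * V ^ 2) / r ^ 2 := by
    field_simp
  have h9 : (U * V / r * D) ^ 2 = (U ^ 2 * V ^ 2 * D ^ 2) / r ^ 2 := by
    field_simp
  rw [h8, h9]
  gcongr

end ObliqueProjection

section SmallestScaling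

variable {F : Type*} [NormedAddCommGroup F] [InnerProductSpace ℝ F]

/-- The reduced discriminant of the quadratic `θ ↦ ‖v‖² θ² - 2 ⟪x, v⟫ θ + a`. -/
def scalingDisc (x : F) (a : ℝ) (v : F) : ℝ := ⟪x, v⟫ ^ 2 - a * ‖v‖ ^ 2

/-- The smallest root of `θ ↦ ‖v‖² θ² - 2 ⟪x, v⟫ θ + a`. For `a = ‖x‖² - ε²` it is the smallest
`θ` with `‖x - θ • v‖ ≤ ε`. -/
def scalingRoot (x : F) (a : ℝ) (v : F) : ℝ := a / (⟪x, v⟫ + √(scalingDisc x a v))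

/-- The gradient of `scalingRoot x a`. -/
def scalingGrad (x : F) (a : ℝ) (v : F) : F :=
  (-(scalingRoot x a v / √(scalingDisc x a v))) • (x - scalingRoot x a v • v)

variable {x v : F} {a : ℝ}

lemma scalingRoot_pos (ha : 0 < a) (hs : 0 < ⟪x, v⟫) : 0 < scalingRoot x a v := by
  unfold scalingRoot
  positivity

lemma scalingRoot_mul_add (hs : 0 < ⟪x, v⟫) :
    scalingRoot x a v * (⟪x, v⟫ + √(scalingDisc x a v)) = a := by
  unfold scalingRoot
  have : 0 < ⟪x, v⟫ + √(scalingDisc x a v) := by positivity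
  field_simp

lemma scalingRoot_mul_norm_sq (hs : 0 < ⟪x, v⟫) (hQ : 0 < scalingDisc x a v) :
    scalingRoot x a v * ‖v‖ ^ 2 = ⟪x, v⟫ - √(scalingDisc x a v) := by
  have hr := Real.sq_sqrt hQ.le
  have hpos : 0 < ⟪x, v⟫ + √(scalingDisc x a v) := by positivity
  have h : a * ‖v‖ ^ 2 = ⟪x, v⟫ ^ 2 - √(scalingDisc x a v) ^ 2 := by
    rw [hr, scalingDisc]
    ring
  rw [scalingRoot, div_mul_eq_mul_div, div_eq_iff hpos.ne', h]
  ring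

lemma inner_sub_scalingRoot_smul (hs : 0 < ⟪x, v⟫) (hQ : 0 < scalingDisc x a v) :
    ⟪x - scalingRoot x a v • v, v⟫ = √(scalingDisc x a v) := by
  rw [inner_sub_left, real_inner_smul_left, real_inner_self_eq_norm_sq,
    scalingRoot_mul_norm_sq hs hQ]
  ring

lemma norm_sub_scalingRoot_smul_sq (hs : 0 < ⟪x, v⟫) (hQ : 0 < scalingDisc x a v) :
    ‖x - scalingRoot x a v • v‖ ^ 2 = ‖x‖ ^ 2 - a := by
  rw [norm_sub_sq_real, inner_smul_right, norm_smul, mul_pow, Real.norm_eq_abs, sq_abs]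
  have h1 := scalingRoot_mul_norm_sq hs hQ
  have h2 := scalingRoot_mul_add (a := a) hs
  linear_combination (scalingRoot x a v) * h1 - h2

lemma hasFDerivAt_scalingRoot (hs : 0 < ⟪x, v⟫) (hQ : 0 < scalingDisc x a v) :
    HasFDerivAt (scalingRoot x a) (innerSL ℝ (scalingGrad x a v)) v := by
  have hsd : HasFDerivAt (fun w : F => ⟪x, w⟫) (innerSL ℝ x) v := (innerSL ℝ x).hasFDerivAt
  have hqd : HasFDerivAt (fun w : F => ‖w‖ ^ 2) (2 • innerSL ℝ v) v :=
    (hasStrictFDerivAt_norm_sq v).hasFDerivAt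
  have hQd := (hsd.pow 2).sub (hqd.const_mul a)
  have hrd := hQd.sqrt (ne_of_gt hQ)
  have hpos : 0 < ⟪x, v⟫ + √(scalingDisc x a v) := by positivity
  have hd := ((hasDerivAt_inv hpos.ne').comp_hasFDerivAt v (hsd.add hrd)).const_mul a
  refine (hd.congr_fderiv ?_).congr_of_eventuallyEq (Filter.Eventually.of_forall fun w => ?_)
  · ext d
    have hr : 0 < √(scalingDisc x a v) := Real.sqrt_pos.2 hQ
    have hθ : scalingRoot x a v = a / (⟪x, v⟫ + √(scalingDisc x a v)) := rfl
    have hQe : √(⟪x, v⟫ ^ 2 - a * ‖v‖ ^ 2) = √(scalingDisc x a v) := rfl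
    simp [scalingGrad, hθ, hQe]
    field_simp
    ring
  · simp [scalingRoot, scalingDisc, div_eq_mul_inv]

lemma hasDerivAt_scalingGrad_line (v₀ d : F) (t : ℝ) (hv : v = v₀ + t • d)
    (hs : 0 < ⟪x, v⟫) (hQ : 0 < scalingDisc x a v) :
    let θ := scalingRoot x a v
    let r := √(scalingDisc x a v)
    let u := x - θ • v
    let w := d - (⟪u, d⟫ / r) • v
    HasDerivAt (fun τ : ℝ => scalingGrad x a (v₀ + τ • d))
      ((2 * θ * ⟪u, d⟫ / r ^ 2) • u + (θ ^ 2 / r) • (w - (⟪v, w⟫ / r) • u)) t := by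
  intro θ r u w
  have hr : 0 < r := Real.sqrt_pos.2 hQ
  have hvd : HasDerivAt (fun τ : ℝ => v₀ + τ • d) d t := by
    simpa using ((hasDerivAt_id t).smul_const d).const_add v₀
  have hθd : HasDerivAt (fun τ : ℝ => scalingRoot x a (v₀ + τ • d)) (⟪scalingGrad x a v, d⟫) t := by
    have h := hasFDerivAt_scalingRoot hs hQ
    rw [hv] at h
    have := h.comp_hasDerivAt t hvd
    rw [← hv] at this
    exact this
  have hsd : HasDerivAt (fun τ : ℝ => ⟪x, v₀ + τ • d⟫) (⟪x, d⟫) t := by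
    simpa using (hasDerivAt_const t x).inner ℝ hvd
  have hqd : HasDerivAt (fun τ : ℝ => ‖v₀ + τ • d‖ ^ 2) (2 * ⟪v, d⟫) t := by
    rw [hv]
    exact hvd.norm_sq
  have hQd : HasDerivAt (fun τ : ℝ => scalingDisc x a (v₀ + τ • d))
      (2 * ⟪x, v⟫ * ⟪x, d⟫ - a * (2 * ⟪v, d⟫)) t := by
    refine ((hsd.pow 2).sub (hqd.const_mul a)).congr_deriv ?_
    simp [hv]
  have hrd : HasDerivAt (fun τ : ℝ => √(scalingDisc x a (v₀ + τ • d)))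
      ((⟪x, v⟫ * ⟪x, d⟫ - a * ⟪v, d⟫) / r) t := by
    refine (hQd.sqrt (by rw [← hv]; exact hQ.ne')).congr_deriv ?_
    rw [← hv]
    change _ / (2 * r) = _
    field_simp
  have hgd := (hθd.div hrd (by rw [← hv]; exact hr.ne')).neg.smul
    ((hasDerivAt_const t x).sub (hθd.smul hvd))
  refine HasDerivAt.congr_deriv hgd ?_
  simp only [Pi.neg_apply, Pi.div_apply, Pi.sub_apply, Pi.smul_apply', ← hv]
  have hG : ⟪scalingGrad x a v, d⟫ = -(θ / r) * ⟪u, d⟫ := by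
    simp [scalingGrad, inner_smul_left, θ, r, u]
  have hxd : ⟪x, d⟫ = ⟪u, d⟫ + θ * ⟪v, d⟫ := by
    simp [u, inner_sub_left, inner_smul_left]
  have h1 : θ * ‖v‖ ^ 2 = ⟪x, v⟫ - r := scalingRoot_mul_norm_sq hs hQ
  have h2 : θ * (⟪x, v⟫ + r) = a := scalingRoot_mul_add (a := a) hs
  have hvw : ⟪v, w⟫ = ⟪v, d⟫ - ⟪u, d⟫ / r * ‖v‖ ^ 2 := by
    simp [w, inner_sub_right, inner_smul_right]
  have hs' : ⟪x, v⟫ = r + θ * ‖v‖ ^ 2 := by linarith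
  have hrd' : ⟪x, v⟫ * ⟪x, d⟫ - a * ⟪v, d⟫
      = ⟪u, d⟫ * (r + θ * ‖v‖ ^ 2) - r * θ * ⟪v, d⟫ := by
    rw [hxd, ← h2, hs']
    ring
  rw [hG, hrd', hvw]
  change (-(θ / r)) • (0 - (θ • d + (-(θ / r) * ⟪u, d⟫) • v)) + (-((-(θ / r) * ⟪u, d⟫ * r
    - θ * ((⟪u, d⟫ * (r + θ * ‖v‖ ^ 2) - r * θ * ⟪v, d⟫) / r)) / r ^ 2)) • u = _
  simp only [w]
  match_scalars <;> field_simp <;> ring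

/-- The norm of the Hessian of `scalingRoot x a` at `v` is at most `(‖x‖² - a) a / r³`, where
`r²` is the discriminant. -/
lemma norm_scalingGrad_deriv_le {ε : ℝ} (hε : 0 ≤ ε) (ha : 0 < a) (hxa : ‖x‖ ^ 2 - a = ε ^ 2)
    (d : F) (hs : 0 < ⟪x, v⟫) (hQ : 0 < scalingDisc x a v) :
    let θ := scalingRoot x a v
    let r := √(scalingDisc x a v)
    let u := x - θ • v
    let w := d - (⟪u, d⟫ / r) • v
    ‖(2 * θ * ⟪u, d⟫ / r ^ 2) • u + (θ ^ 2 / r) • (w - (⟪v, w⟫ / r) • u)‖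
      ≤ ε ^ 2 * a / r ^ 3 * ‖d‖ := by
  intro θ r u w
  have hr : 0 < r := Real.sqrt_pos.2 hQ
  have hθ : 0 < θ := scalingRoot_pos ha hs
  have huv : ⟪u, v⟫ = r := inner_sub_scalingRoot_smul hs hQ
  have hvu : ⟪v, u⟫ = r := by rw [real_inner_comm, huv]
  have hu : ‖u‖ = ε := by
    rw [← sq_eq_sq₀ (norm_nonneg _) hε, ← hxa]
    exact norm_sub_scalingRoot_smul_sq hs hQ
  have hw : ‖w‖ ≤ ε * ‖v‖ / r * ‖d‖ := by
    have := norm_sub_smul_le_of_inner_pos u v d (huv ▸ hr)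
    rwa [huv, hu] at this
  have hw' : ‖w - (⟪v, w⟫ / r) • u‖ ≤ ‖v‖ * ε / r * ‖w‖ := by
    have := norm_sub_smul_le_of_inner_pos v u w (hvu ▸ hr)
    rwa [hvu, hu] at this
  have hp : |⟪u, d⟫| ≤ ε * ‖d‖ := hu ▸ abs_real_inner_le_norm u d
  have h1 : θ * ‖v‖ ^ 2 = ⟪x, v⟫ - r := scalingRoot_mul_norm_sq hs hQ
  have h2 : θ * (⟪x, v⟫ + r) = a := scalingRoot_mul_add (a := a) hs
  calc _ ≤ ‖(2 * θ * ⟪u, d⟫ / r ^ 2) • u‖ + ‖(θ ^ 2 / r) • (w - (⟪v, w⟫ / r) • u)‖ :=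
        norm_add_le _ _
    _ = 2 * θ * |⟪u, d⟫| / r ^ 2 * ε + θ ^ 2 / r * ‖w - (⟪v, w⟫ / r) • u‖ := by
        rw [norm_smul, norm_smul, hu, Real.norm_eq_abs, Real.norm_eq_abs, abs_div, abs_mul,
          abs_of_pos (by positivity : 0 < 2 * θ), abs_of_pos (by positivity : 0 < r ^ 2),
          abs_of_pos (by positivity : 0 < θ ^ 2 / r)]
    _ ≤ 2 * θ * (ε * ‖d‖) / r ^ 2 * ε
          + θ ^ 2 / r * (‖v‖ * ε / r * (ε * ‖v‖ / r * ‖d‖)) := by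
        gcongr
        exact hw'.trans (by gcongr)
    _ = ε ^ 2 * (θ * (2 * r + θ * ‖v‖ ^ 2)) / r ^ 3 * ‖d‖ := by
        field_simp
    _ = ε ^ 2 * a / r ^ 3 * ‖d‖ := by
        rw [h1, ← h2]
        ring

end SmallestScaling

section SmoothRegion

variable {F : Type*} [NormedAddCommGroup F] [InnerProductSpace ℝ F]

/-- The circular cone `⟪x, v⟫ ≥ √k ‖v‖`, intersected with a sublevel set of `scalingRoot x a`. -/
def scalingRegion (x : F) (a k M : ℝ) : Set F :=
  {v | 0 < ⟪x, v⟫ ∧ k * ‖v‖ ^ 2 ≤ ⟪x, v⟫ ^ 2 ∧ scalingRoot x a v ≤ M}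

variable {x v : F} {a k M : ℝ}

lemma scalingDisc_ge (hv : v ∈ scalingRegion x a k M) :
    (k - a) * ‖v‖ ^ 2 ≤ scalingDisc x a v := by
  have := hv.2.1
  unfold scalingDisc
  linarith

lemma norm_pos_of_mem_scalingRegion (hv : v ∈ scalingRegion x a k M) : 0 < ‖v‖ := by
  have := hv.1
  rw [norm_pos_iff]
  rintro rfl
  simp at this

lemma scalingDisc_pos_of_mem_scalingRegion (hak : a < k) (hv : v ∈ scalingRegion x a k M) :
    0 < scalingDisc x a v := by
  have := norm_pos_of_mem_scalingRegion hv
  have h : 0 < k - a := sub_pos.2 hak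
  exact lt_of_lt_of_le (by positivity) (scalingDisc_ge hv)

lemma scalingRoot_le_inv {ε τ : ℝ} (hxa : ‖x‖ ^ 2 - a = ε ^ 2) (ha : 0 < a) (hτ : 0 < τ)
    (hs : 0 < ⟪x, v⟫) (h : ‖τ • x - v‖ ≤ ε * τ) : scalingRoot x a v ≤ τ⁻¹ := by
  have hsq := pow_le_pow_left₀ (norm_nonneg _) h 2
  rw [norm_sub_sq_real, inner_smul_left, norm_smul, mul_pow, Real.norm_eq_abs, sq_abs, mul_pow,
    ← hxa, RCLike.conj_to_real] at hsq
  have hle : a * τ - ⟪x, v⟫ ≤ √(scalingDisc x a v) := by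
    apply Real.le_sqrt_of_sq_le
    unfold scalingDisc
    nlinarith
  have hpos : 0 < ⟪x, v⟫ + √(scalingDisc x a v) := by positivity
  rw [scalingRoot, div_le_iff₀ hpos, inv_mul_eq_div, le_div_iff₀ hτ]
  linarith

lemma norm_inv_scalingRoot_smul_sub {ε : ℝ} (hxa : ‖x‖ ^ 2 - a = ε ^ 2) (hε : 0 ≤ ε) (ha : 0 < a)
    (hs : 0 < ⟪x, v⟫) (hQ : 0 < scalingDisc x a v) :
    ‖(scalingRoot x a v)⁻¹ • x - v‖ = ε * (scalingRoot x a v)⁻¹ := by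
  have hθ := scalingRoot_pos ha hs
  have hu : ‖x - scalingRoot x a v • v‖ = ε := by
    rw [← sq_eq_sq₀ (norm_nonneg _) hε, ← hxa]
    exact norm_sub_scalingRoot_smul_sq hs hQ
  have h : (scalingRoot x a v)⁻¹ • x - v
      = (scalingRoot x a v)⁻¹ • (x - scalingRoot x a v • v) := by
    rw [smul_sub, smul_smul, inv_mul_cancel₀ hθ.ne', one_smul]
  rw [h, norm_smul, hu, Real.norm_of_nonneg (inv_pos.2 hθ).le, mul_comm]

lemma convex_scalingRegion {ε : ℝ} (hxa : ‖x‖ ^ 2 - a = ε ^ 2) (hε : 0 ≤ ε) (ha : 0 < a)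
    (hak : a < k) : Convex ℝ (scalingRegion x a k M) := by
  have hk : 0 < k := ha.trans hak
  have hcone : ∀ v, 0 < ⟪x, v⟫ → (k * ‖v‖ ^ 2 ≤ ⟪x, v⟫ ^ 2 ↔ √k * ‖v‖ ≤ ⟪x, v⟫) := by
    intro v hs
    rw [← sq_le_sq₀ (by positivity) hs.le, mul_pow, Real.sq_sqrt hk.le]
  refine convex_iff_forall_pos.2 fun v hv w hw α β hα hβ hαβ => ?_
  have hsv := hv.1
  have hsw := hw.1
  have hθv := scalingRoot_pos ha hsv
  have hθw := scalingRoot_pos ha hsw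
  have hv' := norm_inv_scalingRoot_smul_sub hxa hε ha hsv (scalingDisc_pos_of_mem_scalingRegion hak hv)
  have hw' := norm_inv_scalingRoot_smul_sub hxa hε ha hsw (scalingDisc_pos_of_mem_scalingRegion hak hw)
  have hs : ⟪x, α • v + β • w⟫ = α * ⟪x, v⟫ + β * ⟪x, w⟫ := by
    rw [inner_add_right, inner_smul_right, inner_smul_right]
  have hspos : 0 < ⟪x, α • v + β • w⟫ := by
    rw [hs]
    positivity
  refine ⟨hspos, (hcone _ hspos).2 ?_, ?_⟩
  · have h1 := (hcone v hsv).1 hv.2.1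
    have h2 := (hcone w hsw).1 hw.2.1
    calc √k * ‖α • v + β • w‖ ≤ √k * (α * ‖v‖ + β * ‖w‖) := by
          gcongr
          refine (norm_add_le _ _).trans_eq ?_
          rw [norm_smul, norm_smul, Real.norm_of_nonneg hα.le, Real.norm_of_nonneg hβ.le]
      _ = α * (√k * ‖v‖) + β * (√k * ‖w‖) := by ring
      _ ≤ _ := by
          rw [hs]
          gcongr
  · have hM : 0 < M := hθv.trans_le hv.2.2
    have hτ : M⁻¹ ≤ α * (scalingRoot x a v)⁻¹ + β * (scalingRoot x a w)⁻¹ := by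
      have h1 := inv_anti₀ hθv hv.2.2
      have h2 := inv_anti₀ hθw hw.2.2
      calc M⁻¹ = α * M⁻¹ + β * M⁻¹ := by rw [← add_mul, hαβ, one_mul]
        _ ≤ _ := by gcongr
    refine (scalingRoot_le_inv hxa ha (lt_of_lt_of_le (inv_pos.2 hM) hτ) hspos ?_).trans
      (inv_le_of_inv_le₀ hM hτ)
    calc _ = ‖α • ((scalingRoot x a v)⁻¹ • x - v) + β • ((scalingRoot x a w)⁻¹ • x - w)‖ := by
          congr 1
          module
      _ ≤ α * (ε * (scalingRoot x a v)⁻¹) + β * (ε * (scalingRoot x a w)⁻¹) := by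
          refine (norm_add_le _ _).trans_eq ?_
          rw [norm_smul, norm_smul, Real.norm_of_nonneg hα.le, Real.norm_of_nonneg hβ.le, hv', hw']
      _ = _ := by ring

lemma sqrt_scalingDisc_ge {ε : ℝ} (hxa : ‖x‖ ^ 2 - a = ε ^ 2) (hε : 0 ≤ ε) (ha : 0 < a)
    (hak : a < k) (hv : v ∈ scalingRegion x a k M) :
    √(k - a) * (‖x‖ - ε) ≤ M * √(scalingDisc x a v) := by
  have hθ := scalingRoot_pos ha hv.1
  have h1 := norm_inv_scalingRoot_smul_sub hxa hε ha hv.1 (scalingDisc_pos_of_mem_scalingRegion hak hv)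
  have h2 : ‖x‖ - ε ≤ scalingRoot x a v * ‖v‖ := by
    have h := norm_sub_norm_le ((scalingRoot x a v)⁻¹ • x) v
    rw [h1, norm_smul, Real.norm_of_nonneg (inv_pos.2 hθ).le] at h
    field_simp at h
    linarith
  have h3 : √(k - a) * ‖v‖ ≤ √(scalingDisc x a v) := by
    apply Real.le_sqrt_of_sq_le
    rw [mul_pow, Real.sq_sqrt (sub_nonneg.2 hak.le)]
    exact scalingDisc_ge hv
  calc √(k - a) * (‖x‖ - ε) ≤ √(k - a) * (scalingRoot x a v * ‖v‖) := by gcongr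
    _ = scalingRoot x a v * (√(k - a) * ‖v‖) := by ring
    _ ≤ M * √(scalingDisc x a v) := by
        gcongr
        · exact hθ.le.trans hv.2.2
        · exact hv.2.2

/-- `scalingGrad x a` is Lipschitz on `scalingRegion x a k M`. -/
lemma norm_scalingGrad_sub_le {ε : ℝ} (hxa : ‖x‖ ^ 2 - a = ε ^ 2) (hε : 0 ≤ ε) (hx : ε < ‖x‖)
    (hak : a < k) {w : F} (hv : v ∈ scalingRegion x a k M) (hw : w ∈ scalingRegion x a k M) :
    ‖scalingGrad x a w - scalingGrad x a v‖
      ≤ ε ^ 2 * M ^ 3 / √(k - a) ^ 3 * ((‖x‖ + ε) / (‖x‖ - ε) ^ 2) * ‖w - v‖ := by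
  have hX : 0 < ‖x‖ - ε := sub_pos.2 hx
  have ha' : a = (‖x‖ - ε) * (‖x‖ + ε) := by linarith
  have ha : 0 < a := ha' ▸ mul_pos hX (by linarith)
  have hM : 0 < M := (scalingRoot_pos ha hv.1).trans_le hv.2.2
  have hδ : 0 < √(k - a) := Real.sqrt_pos.2 (sub_pos.2 hak)
  have hmem : ∀ t ∈ Set.Icc (0 : ℝ) 1, v + t • (w - v) ∈ scalingRegion x a k M := fun t ht =>
    (convex_scalingRegion hxa hε ha hak).add_smul_sub_mem hv hw ht
  have key := norm_image_sub_le_of_norm_deriv_le_segment_01'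
    (f := fun t : ℝ => scalingGrad x a (v + t • (w - v)))
    (C := ε ^ 2 * M ^ 3 / √(k - a) ^ 3 * ((‖x‖ + ε) / (‖x‖ - ε) ^ 2) * ‖w - v‖)
    (fun t ht => (hasDerivAt_scalingGrad_line v (w - v) t rfl (hmem t ht).1
      (scalingDisc_pos_of_mem_scalingRegion hak (hmem t ht))).hasDerivWithinAt) ?_
  · simpa using key
  · intro t ht
    have hm := hmem t ⟨ht.1, ht.2.le⟩
    have hQ := scalingDisc_pos_of_mem_scalingRegion hak hm
    refine (norm_scalingGrad_deriv_le hε ha hxa (w - v) hm.1 hQ).trans ?_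
    gcongr ?_ * _
    have hr : 0 < √(scalingDisc x a (v + t • (w - v))) := Real.sqrt_pos.2 hQ
    have h := pow_le_pow_left₀ (by positivity) (sqrt_scalingDisc_ge hxa hε ha hak hm) 3
    generalize √(scalingDisc x a (v + t • (w - v))) = r at *
    generalize √(k - a) = δ at *
    have hb : 0 ≤ ε ^ 2 * (‖x‖ + ε) := by positivity
    rw [div_mul_div_comm, div_le_div_iff₀ (by positivity) (by positivity), ha']
    calc _ = ε ^ 2 * (‖x‖ + ε) * (δ * (‖x‖ - ε)) ^ 3 := by ring
      _ ≤ ε ^ 2 * (‖x‖ + ε) * (M * r) ^ 3 := by gcongr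
      _ = _ := by ring

end SmoothRegion

section LargestEigenvalue

variable {E F : Type*} [NormedAddCommGroup E] [InnerProductSpace ℝ E] [FiniteDimensional ℝ E]
  [NormedAddCommGroup F] [InnerProductSpace ℝ F] [FiniteDimensional ℝ F]

lemma norm_sq_map_le_of_isGreatest_eigenvalue (φ : E →ₗ[ℝ] F) {lam : ℝ}
    (hlam : IsGreatest {μ : ℝ | Module.End.HasEigenvalue (LinearMap.adjoint φ ∘ₗ φ) μ} lam)
    (d : E) : ‖φ d‖ ^ 2 ≤ lam * ‖d‖ ^ 2 := by
  have hT : (LinearMap.adjoint φ ∘ₗ φ).IsSymmetric := φ.isSymmetric_adjoint_comp_self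
  set b := hT.eigenvectorBasis rfl
  have h1 : ‖φ d‖ ^ 2 = ⟪(LinearMap.adjoint φ ∘ₗ φ) d, d⟫ := by
    rw [LinearMap.comp_apply, LinearMap.adjoint_inner_left, real_inner_self_eq_norm_sq]
  rw [h1, ← b.sum_inner_mul_inner, ← b.sum_sq_norm_inner_right d, Finset.mul_sum]
  refine Finset.sum_le_sum fun i _ => ?_
  rw [hT, hT.apply_eigenvectorBasis, inner_smul_right, Real.norm_eq_abs, sq_abs,
    real_inner_comm d (b i)]
  have h2 : hT.eigenvalues rfl i ≤ lam := hlam.2 (hT.hasEigenvalue_eigenvalues rfl i)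
  have := mul_le_mul_of_nonneg_right h2 (sq_nonneg ⟪b i, d⟫)
  simp only [RCLike.ofReal_real_eq_id, id, b, real_inner_comm d] at *
  nlinarith

lemma nonneg_of_isGreatest_eigenvalue (φ : E →ₗ[ℝ] F) {lam : ℝ}
    (hlam : IsGreatest {μ : ℝ | Module.End.HasEigenvalue (LinearMap.adjoint φ ∘ₗ φ) μ} lam) :
    0 ≤ lam := by
  obtain ⟨d, hd⟩ := Module.End.HasEigenvalue.exists_hasEigenvector hlam.1
  have h := norm_sq_map_le_of_isGreatest_eigenvalue φ hlam d
  have hd' : 0 < ‖d‖ := norm_pos_iff.2 hd.2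
  exact nonneg_of_mul_nonneg_left ((sq_nonneg _).trans h) (by positivity)

lemma norm_map_le_of_isGreatest_eigenvalue (φ : E →ₗ[ℝ] F) {lam : ℝ}
    (hlam : IsGreatest {μ : ℝ | Module.End.HasEigenvalue (LinearMap.adjoint φ ∘ₗ φ) μ} lam)
    (d : E) : ‖φ d‖ ≤ √lam * ‖d‖ := by
  refine le_of_sq_le_sq ?_ (by positivity)
  rw [mul_pow, Real.sq_sqrt (nonneg_of_isGreatest_eigenvalue φ hlam)]
  exact norm_sq_map_le_of_isGreatest_eigenvalue φ hlam d

lemma norm_adjoint_le_of_isGreatest_eigenvalue (φ : E →ₗ[ℝ] F) {lam : ℝ}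
    (hlam : IsGreatest {μ : ℝ | Module.End.HasEigenvalue (LinearMap.adjoint φ ∘ₗ φ) μ} lam)
    (y : F) : ‖LinearMap.adjoint φ y‖ ≤ √lam * ‖y‖ := by
  have h1 : ‖LinearMap.adjoint φ y‖ ^ 2 = ⟪y, φ (LinearMap.adjoint φ y)⟫ := by
    rw [← LinearMap.adjoint_inner_left, real_inner_self_eq_norm_sq]
  have h2 := real_inner_le_norm y (φ (LinearMap.adjoint φ y))
  have h3 := norm_map_le_of_isGreatest_eigenvalue φ hlam (LinearMap.adjoint φ y)
  rcases (norm_nonneg (LinearMap.adjoint φ y)).eq_or_lt with h0 | h0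
  · rw [← h0]
    positivity
  · refine le_of_mul_le_mul_right ?_ h0
    calc _ = ‖LinearMap.adjoint φ y‖ ^ 2 := by ring
      _ ≤ ‖y‖ * ‖φ (LinearMap.adjoint φ y)‖ := h1 ▸ h2
      _ ≤ ‖y‖ * (√lam * ‖LinearMap.adjoint φ y‖) := by gcongr
      _ = _ := by ring

end LargestEigenvalue

section ScalingObjective

variable {H : Type*} [NormedAddCommGroup H] [InnerProductSpace ℝ H] {n : ℕ}
  (φ : H →ₗ[ℝ] EuclideanSpace ℝ (Fin n)) (x : EuclideanSpace ℝ (Fin n))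

lemma etaFun_eq_scalingRoot (ε : ℝ) (h : H) :
    etaFun φ x ε h = scalingRoot x (‖x‖ ^ 2 - ε ^ 2) (φ h) := by
  unfold etaFun scalingRoot
  congr 2
  by_cases h0 : φ h = 0
  · simp [h0, scalingDisc]
  · have hn : 0 < ‖φ h‖ := norm_pos_iff.2 h0
    have hQ : scalingDisc x (‖x‖ ^ 2 - ε ^ 2) (φ h) = ‖φ h‖ ^ 2 * (ε ^ 2 - eFun φ x h) := by
      rw [eFun, if_neg h0, scalingDisc]
      field_simp
      ring
    rw [hQ, Real.sqrt_mul (by positivity), Real.sqrt_sq hn.le]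

lemma map_mem_scalingRegion {ε ebar M : ℝ} {h : H} (hK : h ∈ Kcone φ x ebar)
    (hM : etaFun φ x ε h ≤ M) :
    φ h ∈ scalingRegion x (‖x‖ ^ 2 - ε ^ 2) (‖x‖ ^ 2 - ebar ^ 2) M := by
  obtain ⟨hs, he⟩ := hK
  refine ⟨hs, ?_, etaFun_eq_scalingRoot φ x ε h ▸ hM⟩
  have h0 : φ h ≠ 0 := by
    intro h0
    simp [h0] at hs
  have hn : 0 < ‖φ h‖ := norm_pos_iff.2 h0
  rw [eFun, if_neg h0] at he
  have : ‖x‖ ^ 2 - ebar ^ 2 ≤ ⟪x, φ h⟫ ^ 2 / ‖φ h‖ ^ 2 := by linarith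
  rwa [le_div_iff₀ (by positivity)] at this

lemma gradient_etaFun [FiniteDimensional ℝ H] {ε : ℝ} {h : H} (hs : 0 < ⟪x, φ h⟫)
    (hQ : 0 < scalingDisc x (‖x‖ ^ 2 - ε ^ 2) (φ h)) :
    gradient (etaFun φ x ε) h
      = LinearMap.adjoint φ (scalingGrad x (‖x‖ ^ 2 - ε ^ 2) (φ h)) := by
  refine HasGradientAt.gradient ?_
  have hd := (hasFDerivAt_scalingRoot hs hQ).comp h φ.toContinuousLinearMap.hasFDerivAt
  rw [hasGradientAt_iff_hasFDerivAt]
  refine (hd.congr_fderiv ?_).congr_of_eventuallyEq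
    (Filter.Eventually.of_forall (etaFun_eq_scalingRoot φ x ε))
  ext d
  simp [LinearMap.adjoint_inner_left]

end ScalingObjective

/- STATEMENT 5: `η` is `β`-smooth on `Ĥ(ε̄, η̂) = {h ∈ B_c ∩ K(ε̄) : η(h) ≤ η̂}` with
`β = (ε² η̂³/(ε² - ε̄²)^{3/2})·((‖x‖+ε)/(‖x‖-ε)²)·λ̂(φᵃ∘φ)`. -/
theorem stmt5 {H : Type*} [NormedAddCommGroup H] [InnerProductSpace ℝ H]
    [FiniteDimensional ℝ H] {n : ℕ}
    (φ : H →ₗ[ℝ] EuclideanSpace ℝ (Fin n)) (x : EuclideanSpace ℝ (Fin n))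
    (ε : ℝ) (hε : 0 < ε) (hx : ε < ‖x‖)
    (c : H → ℝ)
    (hhom : ∀ r : ℝ, 0 ≤ r → ∀ f : H, c (r • f) = r * c f)
    (hcpt : IsCompact {f : H | c f ≤ 1})
    (hcvx : Convex ℝ {f : H | c f ≤ 1})
    (hfeas : ∃ f : H, ‖x - φ f‖ < ε)
    (cstar : ℝ) (hcstar : IsLeast {y : ℝ | ∃ f : H, ‖x - φ f‖ ≤ ε ∧ c f = y} cstar)
    (fstar : H) (hf1 : ‖x - φ fstar‖ ≤ ε) (hf2 : c fstar = cstar)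
    (ebar ηhat lamhat : ℝ)
    (heb1 : 0 < ebar) (heb2 : ebar < ε) (heb3 : eFun φ x fstar ≤ ebar ^ 2)
    (hηhat : cstar < ηhat)
    (hlam : IsGreatest
      {μ : ℝ | Module.End.HasEigenvalue ((LinearMap.adjoint φ) ∘ₗ φ) μ} lamhat) :
    ∀ h ∈ {g : H | c g ≤ 1} ∩ Kcone φ x ebar ∩ {g : H | etaFun φ x ε g ≤ ηhat},
    ∀ h' ∈ {g : H | c g ≤ 1} ∩ Kcone φ x ebar ∩ {g : H | etaFun φ x ε g ≤ ηhat},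
      ‖gradient (etaFun φ x ε) h - gradient (etaFun φ x ε) h'‖ ≤
        ε ^ 2 * ηhat ^ 3 / Real.sqrt ((ε ^ 2 - ebar ^ 2) ^ 3) *
          ((‖x‖ + ε) / (‖x‖ - ε) ^ 2) * lamhat * ‖h - h'‖ := by
  intro h hh h' hh'
  have hak : ‖x‖ ^ 2 - ε ^ 2 < ‖x‖ ^ 2 - ebar ^ 2 := by nlinarith
  have hm := map_mem_scalingRegion φ x hh.1.2 hh.2
  have hm' := map_mem_scalingRegion φ x hh'.1.2 hh'.2
  have hX : 0 < ‖x‖ - ε := sub_pos.2 hx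
  have hθ : 0 < scalingRoot x (‖x‖ ^ 2 - ε ^ 2) (φ h) := scalingRoot_pos (by nlinarith) hm.1
  have hη : 0 < ηhat := hθ.trans_le hm.2.2
  have hlam0 := nonneg_of_isGreatest_eigenvalue φ hlam
  have hlip := norm_scalingGrad_sub_le (by ring) hε.le hx hak hm' hm
  have hD : ‖x‖ ^ 2 - ebar ^ 2 - (‖x‖ ^ 2 - ε ^ 2) = ε ^ 2 - ebar ^ 2 := by ring
  have hD0 : 0 ≤ ε ^ 2 - ebar ^ 2 := by linarith
  have hsqrt : √((ε ^ 2 - ebar ^ 2) ^ 3) = √(ε ^ 2 - ebar ^ 2) ^ 3 := by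
    rw [Real.sqrt_eq_iff_eq_sq (by positivity) (by positivity), ← pow_mul, mul_comm, pow_mul,
      Real.sq_sqrt hD0]
  rw [hD, ← hsqrt, ← map_sub] at hlip
  rw [gradient_etaFun φ x hm.1 (scalingDisc_pos_of_mem_scalingRegion hak hm),
    gradient_etaFun φ x hm'.1 (scalingDisc_pos_of_mem_scalingRegion hak hm'), ← map_sub]
  refine (norm_adjoint_le_of_isGreatest_eigenvalue φ hlam _).trans ?_
  have hφ := norm_map_le_of_isGreatest_eigenvalue φ hlam (h - h')
  set B := ε ^ 2 * ηhat ^ 3 / √((ε ^ 2 - ebar ^ 2) ^ 3) * ((‖x‖ + ε) / (‖x‖ - ε) ^ 2)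
  have hB : 0 ≤ B := by positivity
  calc _ ≤ √lamhat * (B * (√lamhat * ‖h - h'‖)) := by
        gcongr
        exact hlip.trans (by gcongr)
    _ = B * √lamhat ^ 2 * ‖h - h'‖ := by ring
    _ = _ := by rw [Real.sq_sqrt hlam0]
end
end

section
/- Every optimal solution f* of the LIP (minimize c(f) subject to ‖x − φ(f)‖ ≤ ε) satisfies e(f*) < ε². -/
open scoped RealInnerProductSpace

noncomputable section

/-- A positively homogeneous function with bounded unit sublevel set is positive off the origin. -/
theorem pos_of_homogeneous_of_isBounded {H : Type*} [NormedAddCommGroup H] [NormedSpace ℝ H]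
    {c : H → ℝ} (hhom : ∀ r : ℝ, 0 ≤ r → ∀ f : H, c (r • f) = r * c f)
    (hbdd : Bornology.IsBounded {f : H | c f ≤ 1}) {h : H} (hh : h ≠ 0) : 0 < c h := by
  by_contra! hc
  obtain ⟨R, hR⟩ := hbdd.exists_norm_le
  have hn : 0 < ‖h‖ := norm_pos_iff.2 hh
  have hr : 0 ≤ (|R| + 1) / ‖h‖ := by positivity
  have hmem : ((|R| + 1) / ‖h‖) • h ∈ {f : H | c f ≤ 1} := by
    simp only [Set.mem_ofPred_eq, hhom _ hr]
    linarith [mul_nonpos_of_nonneg_of_nonpos hr hc]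
  have := hR _ hmem
  rw [norm_smul, Real.norm_of_nonneg hr, div_mul_cancel₀ _ hn.ne'] at this
  linarith [le_abs_self R]

/-- A positively homogeneous function with convex unit sublevel set is sublinear where positive. -/
theorem homogeneous_smul_add_smul_le {H : Type*} [AddCommGroup H] [Module ℝ H]
    {c : H → ℝ} (hhom : ∀ r : ℝ, 0 ≤ r → ∀ f : H, c (r • f) = r * c f)
    (hcvx : Convex ℝ {f : H | c f ≤ 1}) {f g : H} (hf : 0 < c f) (hg : 0 < c g)
    {a b : ℝ} (ha : 0 ≤ a) (hb : 0 < b) : c (a • f + b • g) ≤ a * c f + b * c g := by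
  have hS : 0 < a * c f + b * c g := by positivity
  set S := a * c f + b * c g with hSdef
  have hf1 : (c f)⁻¹ • f ∈ {f : H | c f ≤ 1} := by
    simp [hhom _ (inv_nonneg.2 hf.le), hf.ne']
  have hg1 : (c g)⁻¹ • g ∈ {f : H | c f ≤ 1} := by
    simp [hhom _ (inv_nonneg.2 hg.le), hg.ne']
  have hmem := hcvx hf1 hg1 (a := a * c f / S) (b := b * c g / S) (by positivity) (by positivity)
    (by rw [← add_div, ← hSdef, div_self hS.ne'])
  have heq : (a * c f / S) • (c f)⁻¹ • f + (b * c g / S) • (c g)⁻¹ • g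
      = S⁻¹ • (a • f + b • g) := by
    rw [smul_add, smul_smul, smul_smul, smul_smul, smul_smul]
    congr 2 <;> field_simp
  rw [heq, Set.mem_ofPred_eq, hhom _ (inv_nonneg.2 hS.le), inv_mul_le_iff₀ hS] at hmem
  linarith

/- STATEMENT 7: every optimal solution `f*` of the LIP satisfies `e(f*) < ε²`. -/
theorem stmt7 {H : Type*} [NormedAddCommGroup H] [InnerProductSpace ℝ H]
    [FiniteDimensional ℝ H] {n : ℕ}
    (φ : H →ₗ[ℝ] EuclideanSpace ℝ (Fin n)) (x : EuclideanSpace ℝ (Fin n))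
    (ε : ℝ) (hε : 0 < ε) (hx : ε < ‖x‖)
    (c : H → ℝ)
    (hhom : ∀ r : ℝ, 0 ≤ r → ∀ f : H, c (r • f) = r * c f)
    (hcpt : IsCompact {f : H | c f ≤ 1})
    (hcvx : Convex ℝ {f : H | c f ≤ 1})
    (hfeas : ∃ f : H, ‖x - φ f‖ < ε) :
    ∀ fstar : H,
      (‖x - φ fstar‖ ≤ ε ∧ ∀ f : H, ‖x - φ f‖ ≤ ε → c fstar ≤ c f) →
      eFun φ x fstar < ε ^ 2 := by
  rintro f ⟨hf, hopt⟩
  obtain ⟨g, hg⟩ := hfeas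
  have ne_zero : ∀ h : H, ‖x - φ h‖ ≤ ε → φ h ≠ 0 := by
    intro h hh h0
    rw [h0, sub_zero] at hh
    linarith
  have hy := ne_zero f hf
  have c_pos : ∀ h : H, ‖x - φ h‖ ≤ ε → 0 < c h := fun h hh =>
    pos_of_homogeneous_of_isBounded hhom hcpt.isBounded fun h0 => ne_zero h hh (by simp [h0])
  have hC := c_pos f hf
  have hD := c_pos g hg.le
  by_contra! he
  rw [eFun, if_neg hy] at he
  have hq : 0 < ‖φ f‖ ^ 2 := by positivity
  have hfsq : ‖x - φ f‖ ^ 2 ≤ ε ^ 2 := by gcongr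
  have hexp := norm_sub_sq_real x (φ f)
  have hpq : ⟪x, φ f⟫ = ‖φ f‖ ^ 2 := by
    have h1 : ⟪x, φ f⟫ ^ 2 / ‖φ f‖ ^ 2 ≤ 2 * ⟪x, φ f⟫ - ‖φ f‖ ^ 2 := by linarith
    rw [div_le_iff₀ hq] at h1
    nlinarith [sq_nonneg (⟪x, φ f⟫ - ‖φ f‖ ^ 2)]
  have horth : ⟪x - φ f, φ f⟫ = 0 := by
    rw [inner_sub_left, real_inner_self_eq_norm_sq, hpq, sub_self]
  have hnorm : ε ^ 2 ≤ ‖x - φ f‖ ^ 2 := by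
    have h1 : (‖φ f‖ ^ 2) ^ 2 / ‖φ f‖ ^ 2 = ‖φ f‖ ^ 2 := by field_simp
    rw [hpq, h1] at he
    linarith
  have hdesc : 0 < ⟪x - φ f, φ g⟫ := by
    have h1 : ⟪x - φ f, φ g⟫ = ‖x - φ f‖ ^ 2 - ⟪x - φ f, x - φ g⟫ := by
      have h2 := real_inner_self_eq_norm_sq (x - φ f)
      have h3 := inner_sub_right (𝕜 := ℝ) (x - φ f) x (φ f)
      have h4 := inner_sub_right (𝕜 := ℝ) (x - φ f) x (φ g)
      linarith
    have h2 := real_inner_le_norm (x - φ f) (x - φ g)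
    have h3 : ‖x - φ f‖ * ‖x - φ g‖ ≤ ε * ‖x - φ g‖ := by gcongr
    nlinarith
  set l : ℝ := 2 * c g / c f with hl
  have hlpos : 0 < l := by positivity
  set w := φ g - l • φ f with hw
  have hrw : ⟪x - φ f, w⟫ = ⟪x - φ f, φ g⟫ := by
    rw [hw, inner_sub_right, inner_smul_right, horth, mul_zero, sub_zero]
  obtain ⟨t, ht, htl, htw⟩ : ∃ t : ℝ, 0 < t ∧ t * l ≤ 1 ∧ t * ‖w‖ ^ 2 ≤ 2 * ⟪x - φ f, φ g⟫ := by
    refine ⟨min (1 / l) (2 * ⟪x - φ f, φ g⟫ / (‖w‖ ^ 2 + 1)), by positivity, ?_, ?_⟩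
    · rw [← le_div_iff₀ hlpos]
      exact min_le_left _ _
    · have h1 := min_le_right (1 / l) (2 * ⟪x - φ f, φ g⟫ / (‖w‖ ^ 2 + 1))
      rw [le_div_iff₀ (by positivity)] at h1
      have h2 : 0 < min (1 / l) (2 * ⟪x - φ f, φ g⟫ / (‖w‖ ^ 2 + 1)) := by positivity
      linarith
  have hres : x - φ ((1 - t * l) • f + t • g) = (x - φ f) - t • w := by
    rw [hw, map_add, map_smul, map_smul]
    module
  have hfeas' : ‖x - φ ((1 - t * l) • f + t • g)‖ ≤ ε := by
    rw [hres]
    refine (sq_le_sq₀ (norm_nonneg _) hε.le).1 ?_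
    rw [norm_sub_sq_real, inner_smul_right, hrw, norm_smul, Real.norm_of_nonneg ht.le]
    nlinarith
  have hle := (hopt _ hfeas').trans
    (homogeneous_smul_add_smul_le hhom hcvx hC hD (sub_nonneg.2 htl) ht)
  have hlC : l * c f = 2 * c g := by rw [hl]; field_simp
  have hmul : t * l * c f = 2 * (t * c g) := by rw [mul_assoc, hlC]; ring
  have : 0 < t * c g := by positivity
  linarith
end
end

section
/- Let c* be the optimal value of the LIP and f* an optimal solution. For any ε̄, η̂ with e(f*) ≤ ε̄² < ε² and c* < η̂, consider the set Ĥ(ε̄, η̂) = {h ∈ B_c ∩ K(ε̄) : η(h) ≤ η̂}. Then the minimization of η over Ĥ(ε̄, η̂) is equivalent to the LIP: its optimal value equals c*, and h* is an optimal solution of min_{h ∈ Ĥ(ε̄, η̂)} η(h) if and only if c*·h* is an optimal solution of the LIP. -/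
open scoped RealInnerProductSpace

noncomputable section

theorem eFun_smul {H : Type*} [NormedAddCommGroup H] [InnerProductSpace ℝ H] {n : ℕ}
    (φ : H →ₗ[ℝ] EuclideanSpace ℝ (Fin n)) (x : EuclideanSpace ℝ (Fin n))
    {r : ℝ} (hr : 0 < r) (h : H) : eFun φ x (r • h) = eFun φ x h := by
  unfold eFun
  by_cases h0 : φ h = 0
  · simp [h0]
  · have hn : ‖φ h‖ ≠ 0 := norm_ne_zero_iff.mpr h0
    have hrn : r • φ h ≠ 0 := smul_ne_zero hr.ne' h0
    rw [map_smul, if_neg hrn, if_neg h0, real_inner_smul_right, norm_smul, Real.norm_eq_abs,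
      abs_of_pos hr]
    field_simp

theorem norm_sub_smul_sq {E : Type*} [NormedAddCommGroup E] [InnerProductSpace ℝ E]
    (x y : E) (t : ℝ) :
    ‖x - t • y‖ ^ 2 = ‖x‖ ^ 2 - 2 * t * ⟪x, y⟫ + t ^ 2 * ‖y‖ ^ 2 := by
  rw [norm_sub_sq_real, real_inner_smul_right, norm_smul, mul_pow, Real.norm_eq_abs, sq_abs]
  ring

/-- The quantity under the root in `etaFun` is the reduced discriminant of the quadratic
inequality `‖x - t • φ h‖ ^ 2 ≤ ε ^ 2` in `t`. -/
theorem sq_norm_mul_eFun {H : Type*} [NormedAddCommGroup H] [InnerProductSpace ℝ H] {n : ℕ}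
    (φ : H →ₗ[ℝ] EuclideanSpace ℝ (Fin n)) (x : EuclideanSpace ℝ (Fin n)) (ε : ℝ) (h : H) :
    ‖φ h‖ ^ 2 * (ε ^ 2 - eFun φ x h) =
      ⟪x, φ h⟫ ^ 2 - ‖φ h‖ ^ 2 * (‖x‖ ^ 2 - ε ^ 2) := by
  unfold eFun
  by_cases h0 : φ h = 0
  · simp [h0]
  · have hn : ‖φ h‖ ≠ 0 := norm_ne_zero_iff.mpr h0
    rw [if_neg h0]
    field_simp
    ring

theorem etaFun_pos {H : Type*} [NormedAddCommGroup H] [InnerProductSpace ℝ H] {n : ℕ}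
    (φ : H →ₗ[ℝ] EuclideanSpace ℝ (Fin n)) (x : EuclideanSpace ℝ (Fin n))
    {ε : ℝ} (hε : 0 < ε) (hx : ε < ‖x‖) {h : H} (ha : 0 < ⟪x, φ h⟫) :
    0 < etaFun φ x ε h := by
  have hK : 0 < ‖x‖ ^ 2 - ε ^ 2 := by nlinarith
  unfold etaFun
  positivity

theorem norm_sub_etaFun_smul_le {H : Type*} [NormedAddCommGroup H] [InnerProductSpace ℝ H]
    {n : ℕ} (φ : H →ₗ[ℝ] EuclideanSpace ℝ (Fin n)) (x : EuclideanSpace ℝ (Fin n))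
    {ε : ℝ} (hε : 0 < ε) {h : H} (ha : 0 < ⟪x, φ h⟫) (he : eFun φ x h ≤ ε ^ 2) :
    ‖x - φ (etaFun φ x ε h • h)‖ ≤ ε := by
  have hs2 : (‖φ h‖ * √(ε ^ 2 - eFun φ x h)) ^ 2 =
      ⟪x, φ h⟫ ^ 2 - ‖φ h‖ ^ 2 * (‖x‖ ^ 2 - ε ^ 2) := by
    rw [mul_pow, Real.sq_sqrt (sub_nonneg.mpr he), sq_norm_mul_eFun]
  have hs : 0 ≤ ‖φ h‖ * √(ε ^ 2 - eFun φ x h) := by positivity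
  refine le_of_sq_le_sq ?_ hε.le
  rw [map_smul, norm_sub_smul_sq]
  unfold etaFun
  set s := ‖φ h‖ * √(ε ^ 2 - eFun φ x h)
  set a := ⟪x, φ h⟫
  have hne : a + s ≠ 0 := by positivity
  refine le_of_eq ?_
  field_simp
  linear_combination (‖x‖ ^ 2 - ε ^ 2) * hs2

theorem inner_pos_of_norm_sub_smul_le {E : Type*} [NormedAddCommGroup E]
    [InnerProductSpace ℝ E] {x y : E} {ε t : ℝ} (hε : 0 < ε) (hx : ε < ‖x‖) (ht : 0 < t)
    (hf : ‖x - t • y‖ ≤ ε) : 0 < ⟪x, y⟫ := by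
  have hf2 : ‖x - t • y‖ ^ 2 ≤ ε ^ 2 := pow_le_pow_left₀ (norm_nonneg _) hf 2
  rw [norm_sub_smul_sq] at hf2
  have hK : 0 < ‖x‖ ^ 2 - ε ^ 2 := by nlinarith
  have hb : 0 ≤ t ^ 2 * ‖y‖ ^ 2 := by positivity
  exact pos_of_mul_pos_right (b := ⟪x, y⟫) (by nlinarith : 0 < t * ⟪x, y⟫) ht.le

theorem etaFun_le_of_norm_sub_smul_le {H : Type*} [NormedAddCommGroup H]
    [InnerProductSpace ℝ H] {n : ℕ}
    (φ : H →ₗ[ℝ] EuclideanSpace ℝ (Fin n)) (x : EuclideanSpace ℝ (Fin n))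
    {ε : ℝ} (hε : 0 < ε) (hx : ε < ‖x‖) {h : H} {t : ℝ} (ht : 0 < t)
    (he : eFun φ x h ≤ ε ^ 2) (hf : ‖x - φ (t • h)‖ ≤ ε) :
    etaFun φ x ε h ≤ t := by
  rw [map_smul] at hf
  have ha := inner_pos_of_norm_sub_smul_le hε hx ht hf
  have hf2 : ‖x - t • φ h‖ ^ 2 ≤ ε ^ 2 := pow_le_pow_left₀ (norm_nonneg _) hf 2
  rw [norm_sub_smul_sq] at hf2
  have hs2 : (‖φ h‖ * √(ε ^ 2 - eFun φ x h)) ^ 2 =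
      ⟪x, φ h⟫ ^ 2 - ‖φ h‖ ^ 2 * (‖x‖ ^ 2 - ε ^ 2) := by
    rw [mul_pow, Real.sq_sqrt (sub_nonneg.mpr he), sq_norm_mul_eFun]
  have hs : 0 ≤ ‖φ h‖ * √(ε ^ 2 - eFun φ x h) := by positivity
  unfold etaFun
  set s := ‖φ h‖ * √(ε ^ 2 - eFun φ x h)
  set a := ⟪x, φ h⟫
  have hroot : a - t * ‖φ h‖ ^ 2 ≤ s := by
    refine le_of_sq_le_sq ?_ hs
    nlinarith [mul_le_mul_of_nonneg_left hf2 (sq_nonneg ‖φ h‖)]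
  rw [div_le_iff₀ (by positivity)]
  nlinarith [mul_le_mul_of_nonneg_left hroot ht.le]

/-- A positively homogeneous function with bounded unit sublevel set is positive away from
the origin. -/
theorem pos_of_isBounded_sublevel {H : Type*} [NormedAddCommGroup H] [NormedSpace ℝ H]
    {c : H → ℝ} (hhom : ∀ r : ℝ, 0 ≤ r → ∀ f : H, c (r • f) = r * c f)
    (hbdd : Bornology.IsBounded {f : H | c f ≤ 1}) {f : H} (hf : f ≠ 0) : 0 < c f := by
  by_contra! hle
  obtain ⟨R, hR⟩ := hbdd.exists_norm_le
  have hn : 0 < ‖f‖ := norm_pos_iff.mpr hf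
  have hr : 0 ≤ (|R| + 1) / ‖f‖ := by positivity
  have hmem := hR (((|R| + 1) / ‖f‖) • f) (by
    rw [Set.mem_ofPred_eq, hhom _ hr]
    nlinarith)
  rw [norm_smul, Real.norm_eq_abs, abs_of_nonneg hr, div_mul_cancel₀ _ hn.ne'] at hmem
  linarith [le_abs_self R]

/-- Sublevel sets of a positively homogeneous function inherit midpoint convexity from the
unit sublevel set. -/
theorem midpoint_le_of_convex_sublevel {H : Type*} [NormedAddCommGroup H] [NormedSpace ℝ H]
    {c : H → ℝ} (hhom : ∀ r : ℝ, 0 ≤ r → ∀ f : H, c (r • f) = r * c f)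
    (hcvx : Convex ℝ {f : H | c f ≤ 1}) {m : ℝ} (hm : 0 < m) {f g : H}
    (hf : c f ≤ m) (hg : c g ≤ m) : c ((1 / 2 : ℝ) • (f + g)) ≤ m := by
  have hscale : ∀ u : H, c u ≤ m ↔ c (m⁻¹ • u) ≤ 1 := fun u => by
    rw [hhom _ (inv_nonneg.mpr hm.le), inv_mul_le_iff₀ hm, mul_one]
  have key := hcvx ((hscale f).mp hf) ((hscale g).mp hg)
    (by norm_num : (0 : ℝ) ≤ 1 / 2) (by norm_num : (0 : ℝ) ≤ 1 / 2) (by norm_num)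
  have hsplit : m⁻¹ • (1 / 2 : ℝ) • (f + g) =
      (1 / 2 : ℝ) • m⁻¹ • f + (1 / 2 : ℝ) • m⁻¹ • g := by module
  rw [hscale, hsplit]
  exact key

theorem norm_sub_half_add_lt {E : Type*} [NormedAddCommGroup E] [InnerProductSpace ℝ E]
    {x y z : E} {ε : ℝ} (hε : 0 < ε) (hy : ‖x - y‖ ≤ ε) (hz : ‖x - z‖ ≤ ε) (hne : y ≠ z) :
    ‖x - (1 / 2 : ℝ) • (y + z)‖ < ε := by
  have hpar := parallelogram_law_with_norm ℝ (x - y) (x - z)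
  have hd : 0 < ‖(x - y) - (x - z)‖ := by
    rw [norm_pos_iff, sub_sub_sub_cancel_left, sub_ne_zero]
    exact hne.symm
  have hmid : x - (1 / 2 : ℝ) • (y + z) = (1 / 2 : ℝ) • ((x - y) + (x - z)) := by module
  have hy2 := mul_self_le_mul_self (norm_nonneg _) hy
  have hz2 := mul_self_le_mul_self (norm_nonneg _) hz
  have hlt : ‖(x - y) + (x - z)‖ < 2 * ε :=
    lt_of_mul_self_lt_mul_self₀ (by positivity) (by nlinarith)
  rw [hmid, norm_smul]
  norm_num
  linarith

/-- A point satisfying the constraint strictly has cost above the optimal value. -/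
theorem lt_cost_of_norm_sub_lt {H : Type*} [NormedAddCommGroup H] [NormedSpace ℝ H]
    {E : Type*} [NormedAddCommGroup E] [NormedSpace ℝ E] (φ : H →ₗ[ℝ] E) {x : E} {ε : ℝ}
    (hx : ε < ‖x‖) {c : H → ℝ} (hhom : ∀ r : ℝ, 0 ≤ r → ∀ f : H, c (r • f) = r * c f)
    {m : ℝ} (hm : 0 < m) (hmin : ∀ f : H, ‖x - φ f‖ ≤ ε → m ≤ c f) {g : H}
    (hg : ‖x - φ g‖ < ε) : m < c g := by
  by_contra! hle
  have hd : 0 < ‖x‖ - ‖x - φ g‖ := by linarith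
  set t := (‖x‖ - ε) / (‖x‖ - ‖x - φ g‖) with ht
  have ht0 : 0 ≤ t := div_nonneg (by linarith) hd.le
  have ht1 : t < 1 := by rw [ht, div_lt_one hd]; linarith
  have htd : t * (‖x‖ - ‖x - φ g‖) = ‖x‖ - ε := div_mul_cancel₀ _ hd.ne'
  have hfeas : ‖x - φ (t • g)‖ ≤ ε := by
    have hsplit : x - φ (t • g) = t • (x - φ g) + (1 - t) • x := by
      rw [map_smul]
      module
    rw [hsplit]
    refine (norm_add_le _ _).trans ?_
    rw [norm_smul, norm_smul, Real.norm_eq_abs, Real.norm_eq_abs, abs_of_nonneg ht0,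
      abs_of_pos (by linarith)]
    linarith
  have hcost := hmin _ hfeas
  rw [hhom t ht0] at hcost
  nlinarith

/- STATEMENT 8: the smooth minimization of `η` over `Ĥ(ε̄, η̂)` is equivalent to the
LIP: its optimal value equals `c*`, and `h*` solves it iff `c* • h*` solves the LIP. -/
theorem stmt8 {H : Type*} [NormedAddCommGroup H] [InnerProductSpace ℝ H]
    [FiniteDimensional ℝ H] {n : ℕ}
    (φ : H →ₗ[ℝ] EuclideanSpace ℝ (Fin n)) (x : EuclideanSpace ℝ (Fin n))
    (ε : ℝ) (hε : 0 < ε) (hx : ε < ‖x‖)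
    (c : H → ℝ)
    (hhom : ∀ r : ℝ, 0 ≤ r → ∀ f : H, c (r • f) = r * c f)
    (hcpt : IsCompact {f : H | c f ≤ 1})
    (hcvx : Convex ℝ {f : H | c f ≤ 1})
    (hfeas : ∃ f : H, ‖x - φ f‖ < ε)
    (cstar : ℝ) (hcstar : IsLeast {y : ℝ | ∃ f : H, ‖x - φ f‖ ≤ ε ∧ c f = y} cstar)
    (fstar : H) (hf1 : ‖x - φ fstar‖ ≤ ε) (hf2 : c fstar = cstar)
    (ebar ηhat : ℝ)
    (heb : eFun φ x fstar ≤ ebar ^ 2) (heb2 : ebar ^ 2 < ε ^ 2) (hηhat : cstar < ηhat) :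
    sInf (etaFun φ x ε ''
        ({g : H | c g ≤ 1} ∩ Kcone φ x ebar ∩ {g : H | etaFun φ x ε g ≤ ηhat})) = cstar ∧
    (∀ hstar : H,
      (hstar ∈ {g : H | c g ≤ 1} ∩ Kcone φ x ebar ∩ {g : H | etaFun φ x ε g ≤ ηhat} ∧
        ∀ h ∈ {g : H | c g ≤ 1} ∩ Kcone φ x ebar ∩ {g : H | etaFun φ x ε g ≤ ηhat},
          etaFun φ x ε hstar ≤ etaFun φ x ε h) ↔
      (‖x - φ (cstar • hstar)‖ ≤ ε ∧
        ∀ f : H, ‖x - φ f‖ ≤ ε → c (cstar • hstar) ≤ c f)) := by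
  have hmin : ∀ f : H, ‖x - φ f‖ ≤ ε → cstar ≤ c f := fun f hf => hcstar.2 ⟨f, hf, rfl⟩
  have hfne : fstar ≠ 0 := by
    rintro rfl
    rw [map_zero, sub_zero] at hf1
    linarith
  have hpos : 0 < cstar := hf2 ▸ pos_of_isBounded_sublevel hhom hcpt.isBounded hfne
  have huniq : ∀ f : H, ‖x - φ f‖ ≤ ε → c f ≤ cstar → φ f = φ fstar := by
    intro f hf hcf
    by_contra hne
    have hlt := norm_sub_half_add_lt hε hf hf1 hne
    rw [← map_add, ← map_smul] at hlt
    exact (lt_cost_of_norm_sub_lt φ hx hhom hpos hmin hlt).not_ge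
      (midpoint_le_of_convex_sublevel hhom hcvx hpos hcf hf2.le)
  set S := {g : H | c g ≤ 1} ∩ Kcone φ x ebar ∩ {g : H | etaFun φ x ε g ≤ ηhat}
  have hfeasible : ∀ h ∈ S, ‖x - φ (etaFun φ x ε h • h)‖ ≤ ε := fun h hh =>
    norm_sub_etaFun_smul_le φ x hε hh.1.2.1 (hh.1.2.2.trans heb2.le)
  have hlower : ∀ h ∈ S, cstar ≤ etaFun φ x ε h := by
    intro h hh
    have heta := etaFun_pos φ x hε hx hh.1.2.1
    have hcost := hmin _ (hfeasible h hh)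
    rw [hhom _ heta.le] at hcost
    exact hcost.trans (mul_le_of_le_one_right heta.le hh.1.1)
  have hupper : ∀ h : H, ‖x - φ (cstar • h)‖ ≤ ε → c (cstar • h) ≤ cstar →
      h ∈ S ∧ etaFun φ x ε h = cstar := by
    intro h hf hc
    have heq : eFun φ x h = eFun φ x fstar := by
      rw [← eFun_smul φ x hpos h]
      simp only [eFun, huniq _ hf hc]
    have he : eFun φ x h ≤ ebar ^ 2 := heq.trans_le heb
    have hle := etaFun_le_of_norm_sub_smul_le φ x hε hx hpos (he.trans heb2.le) hf
    rw [hhom _ hpos.le] at hc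
    have hc1 : c h ≤ 1 := le_of_mul_le_mul_left (by rwa [mul_one]) hpos
    have ha : 0 < ⟪x, φ h⟫ :=
      inner_pos_of_norm_sub_smul_le hε hx hpos (by rwa [map_smul] at hf)
    have hmem : h ∈ S := ⟨⟨hc1, ha, he⟩, hle.trans hηhat.le⟩
    exact ⟨hmem, hle.antisymm (hlower h hmem)⟩
  have hscaled : cstar • (cstar⁻¹ • fstar) = fstar := smul_inv_smul₀ hpos.ne' fstar
  obtain ⟨hmem₀, heta₀⟩ := hupper (cstar⁻¹ • fstar) (by rwa [hscaled]) (by rw [hscaled, hf2])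
  refine ⟨IsLeast.csInf_eq ⟨⟨_, hmem₀, heta₀⟩, ?_⟩, fun hstar => ⟨?_, ?_⟩⟩
  · rintro _ ⟨h, hh, rfl⟩
    exact hlower h hh
  · rintro ⟨hmem, hopt⟩
    have heta : etaFun φ x ε hstar = cstar :=
      ((hopt _ hmem₀).trans_eq heta₀).antisymm (hlower _ hmem)
    refine ⟨heta ▸ hfeasible _ hmem, fun f hf => ?_⟩
    rw [hhom _ hpos.le]
    exact (mul_le_of_le_one_right hpos.le hmem.1.1).trans (hmin f hf)
  · rintro ⟨hf, hopt⟩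
    obtain ⟨hmem, heta⟩ := hupper hstar hf ((hopt fstar hf1).trans_eq hf2)
    exact ⟨hmem, fun h hh => heta.trans_le (hlower h hh)⟩
end
end

section
/- Let c'(f) = max over h ∈ B_c of ⟨f, h⟩ denote the dual function of c. Then the quantity η̄ = ‖x‖·(‖x‖ − ε) / c'(φᵃ(x)) is a positive lower bound on the optimal value c* of the LIP, i.e. 0 < η̄ ≤ c*. -/
open scoped RealInnerProductSpace

noncomputable section

/- STATEMENT 9: `η̄ = ‖x‖(‖x‖ - ε)/c'(φᵃ(x))`, where `c'(f) = max_{h ∈ B_c} ⟨f, h⟩`,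
is a positive lower bound on the optimal value `c*` of the LIP. -/
theorem stmt9 {H : Type*} [NormedAddCommGroup H] [InnerProductSpace ℝ H]
    [FiniteDimensional ℝ H] {n : ℕ}
    (φ : H →ₗ[ℝ] EuclideanSpace ℝ (Fin n)) (x : EuclideanSpace ℝ (Fin n))
    (ε : ℝ) (hε : 0 < ε) (hx : ε < ‖x‖)
    (c : H → ℝ)
    (hhom : ∀ r : ℝ, 0 ≤ r → ∀ f : H, c (r • f) = r * c f)
    (hcpt : IsCompact {f : H | c f ≤ 1})
    (hcvx : Convex ℝ {f : H | c f ≤ 1})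
    (hfeas : ∃ f : H, ‖x - φ f‖ < ε)
    (cstar : ℝ) (hcstar : IsLeast {y : ℝ | ∃ f : H, ‖x - φ f‖ ≤ ε ∧ c f = y} cstar) :
    0 < ‖x‖ * (‖x‖ - ε) /
        sSup ((fun h : H => ⟪(LinearMap.adjoint φ) x, h⟫) '' {g : H | c g ≤ 1}) ∧
    ‖x‖ * (‖x‖ - ε) /
        sSup ((fun h : H => ⟪(LinearMap.adjoint φ) x, h⟫) '' {g : H | c g ≤ 1}) ≤
      cstar := by
  obtain ⟨⟨f, hf, rfl⟩, -⟩ := hcstar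
  set a := (LinearMap.adjoint φ) x with ha
  have hbdd : BddAbove ((fun h : H => ⟪a, h⟫) '' {g : H | c g ≤ 1}) :=
    (hcpt.image (by fun_prop)).bddAbove
  set S := sSup ((fun h : H => ⟪a, h⟫) '' {g : H | c g ≤ 1}) with hS
  have le_dual (g : H) (hg : c g ≤ 1) : ⟪a, g⟫ ≤ S := le_csSup hbdd ⟨g, hg, rfl⟩
  have hnum : 0 < ‖x‖ * (‖x‖ - ε) := mul_pos (hε.trans hx) (sub_pos.2 hx)
  have hinner : ‖x‖ * (‖x‖ - ε) ≤ ⟪a, f⟫ := by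
    have hCS : ⟪x, x - φ f⟫ ≤ ‖x‖ * ε :=
      (real_inner_le_norm _ _).trans (mul_le_mul_of_nonneg_left hf (norm_nonneg _))
    rw [inner_sub_right, real_inner_self_eq_norm_sq] at hCS
    rw [ha, LinearMap.adjoint_inner_left]
    linarith
  have haf : 0 < ⟪a, f⟫ := hnum.trans_le hinner
  have hcf : 0 < c f := by
    by_contra! hneg
    have hr : 0 ≤ (|S| + 1) / ⟪a, f⟫ := by positivity
    have hle := le_dual (((|S| + 1) / ⟪a, f⟫) • f) <| by
      rw [hhom _ hr]
      exact (mul_nonpos_of_nonneg_of_nonpos hr hneg).trans zero_le_one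
    rw [real_inner_smul_right, div_mul_cancel₀ _ haf.ne'] at hle
    linarith [le_abs_self S]
  have hmul : ⟪a, f⟫ ≤ c f * S := by
    have hle := le_dual ((c f)⁻¹ • f) <| by
      rw [hhom _ (inv_nonneg.2 hcf.le), inv_mul_cancel₀ hcf.ne']
    rwa [real_inner_smul_right, inv_mul_le_iff₀ hcf] at hle
  have hSpos : 0 < S := pos_of_mul_pos_right (haf.trans_le hmul) hcf.le
  exact ⟨div_pos hnum hSpos, (div_le_iff₀ hSpos).2 (hinner.trans hmul)⟩
end
end

section
/- For any η̄, B > 0, on the set Λ̄(η̄, B) = {λ ∈ ℝⁿ : ⟨λ, x⟩ − ε‖λ‖ > 0, l(λ) ≥ η̄, ‖λ‖ ≤ B}, the map λ ↦ −2·l(λ) is α'-strongly convex and β'-smooth, where α' = (ε/(‖x‖² − ε²))·(η̄/B)³ and β' = (‖x‖² − ε²)/(2·η̄³). -/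
open scoped RealInnerProductSpace

noncomputable section

/- `l(λ) = √(⟨λ, x⟩ - ε‖λ‖)`. -/
def lFun {n : ℕ} (x : EuclideanSpace ℝ (Fin n)) (ε : ℝ)
    (lam : EuclideanSpace ℝ (Fin n)) : ℝ :=
  Real.sqrt (⟪lam, x⟫ - ε * ‖lam‖)

/- The set `Λ̄(η̄, B) = {λ : ⟨λ, x⟩ - ε‖λ‖ > 0, l(λ) ≥ η̄, ‖λ‖ ≤ B}`. -/
def LamBar {n : ℕ} (x : EuclideanSpace ℝ (Fin n)) (ε ηbar B : ℝ) :
    Set (EuclideanSpace ℝ (Fin n)) :=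
  {lam | 0 < ⟪lam, x⟫ - ε * ‖lam‖ ∧ ηbar ≤ lFun x ε lam ∧ ‖lam‖ ≤ B}

open Set

section Calculus

variable {E : Type*} [NormedAddCommGroup E] [InnerProductSpace ℝ E]

theorem add_deriv_add_half_le_of_le_second_deriv {f f' f'' : ℝ → ℝ} {A : ℝ}
    (hf : ∀ t ∈ Icc (0 : ℝ) 1, HasDerivAt f (f' t) t)
    (hf' : ∀ t ∈ Icc (0 : ℝ) 1, HasDerivAt f' (f'' t) t)
    (hA : ∀ t ∈ Icc (0 : ℝ) 1, A ≤ f'' t) :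
    f 0 + f' 0 + A / 2 ≤ f 1 := by
  have key : ∀ g g' : ℝ → ℝ, (∀ t ∈ Icc (0 : ℝ) 1, HasDerivAt g (g' t) t) →
      (∀ t ∈ Icc (0 : ℝ) 1, 0 ≤ g' t) → MonotoneOn g (Icc 0 1) := by
    intro g g' hg hg'
    refine monotoneOn_of_hasDerivWithinAt_nonneg (f' := g') (convex_Icc 0 1)
      (fun t ht => (hg t ht).continuousAt.continuousWithinAt) ?_ ?_
    · intro t ht
      exact (hg t (interior_subset ht)).hasDerivWithinAt
    · intro t ht
      exact hg' t (interior_subset ht)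
  have h0 : (0 : ℝ) ∈ Icc (0 : ℝ) 1 := by simp
  have h1 : (1 : ℝ) ∈ Icc (0 : ℝ) 1 := by simp
  have slope : ∀ t ∈ Icc (0 : ℝ) 1, f' 0 + A * t ≤ f' t := by
    intro t ht
    have hm := key (fun s => f' s - A * s) (fun s => f'' s - A * 1)
      (fun s hs => (hf' s hs).sub ((hasDerivAt_id s).const_mul A))
      (fun s hs => by linarith [hA s hs]) h0 ht ht.1
    simp only at hm
    linarith
  have hm := key (fun s => f s - f' 0 * s - A / 2 * s ^ 2)
    (fun s => f' s - f' 0 * 1 - A / 2 * (2 * s))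
    (fun s hs => by
      have h2 : HasDerivAt (fun s : ℝ => s ^ 2) (2 * s) s := by
        simpa using hasDerivAt_pow 2 s
      exact ((hf s hs).sub ((hasDerivAt_id s).const_mul _)).sub (h2.const_mul _))
    (fun s hs => by linarith [slope s hs]) h0 h1 zero_le_one
  simp only at hm
  linarith

theorem hasFDerivAt_norm_of_ne_zero {y : E} (hy : y ≠ 0) :
    HasFDerivAt (fun z : E => ‖z‖) (innerSL ℝ (‖y‖⁻¹ • y)) y := by
  have hn : ‖y‖ ≠ 0 := norm_ne_zero_iff.mpr hy
  have h := ((hasStrictFDerivAt_norm_sq y).hasFDerivAt).sqrt (pow_ne_zero 2 hn)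
  simp only [Real.sqrt_sq (norm_nonneg _)] at h
  refine h.congr_fderiv ?_
  ext k
  simp
  field_simp

theorem inner_sub_smul_sq_le {u : E} (hu : ‖u‖ = 1) (x h : E) :
    (⟪x, h⟫ - ⟪u, x⟫ * ⟪u, h⟫) ^ 2 ≤
      (‖x‖ ^ 2 - ⟪u, x⟫ ^ 2) * (‖h‖ ^ 2 - ⟪u, h⟫ ^ 2) := by
  have hcs := real_inner_mul_inner_self_le (x - ⟪u, x⟫ • u) (h - ⟪u, h⟫ • u)
  simp only [inner_sub_left, inner_sub_right, inner_smul_left, inner_smul_right,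
    real_inner_self_eq_norm_sq, hu, real_inner_comm u, RCLike.conj_to_real] at hcs
  nlinarith [hcs]

end Calculus

theorem rank_two_quadratic_form_lower_bound {p s2 b2 a e ε : ℝ} (hε : 0 < ε) (hp : 0 < p)
    (hs : 0 ≤ s2) (hb : 0 ≤ b2) (he : e ^ 2 ≤ s2 * b2) :
    2 * ε * p ^ 3 * (a ^ 2 + b2) ≤
      ((p * a + e) ^ 2 + 2 * ε * p * b2) * (p ^ 2 + s2 + 2 * ε * p) := by
  obtain ⟨s, hs0, rfl⟩ : ∃ s : ℝ, 0 ≤ s ∧ s2 = s ^ 2 :=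
    ⟨√s2, Real.sqrt_nonneg _, (Real.sq_sqrt hs).symm⟩
  obtain ⟨b, hb0, rfl⟩ : ∃ b : ℝ, 0 ≤ b ∧ b2 = b ^ 2 :=
    ⟨√b2, Real.sqrt_nonneg _, (Real.sq_sqrt hb).symm⟩
  obtain ⟨r, hr⟩ : ∃ r, r = p * a + e := ⟨_, rfl⟩
  have hpa : p * a = r - e := by linarith
  have hεp : 0 < ε * p := mul_pos hε hp
  have habs : |e| ≤ s * b := abs_le_of_sq_le_sq (by nlinarith) (by positivity)
  have hre : -(|r| * (s * b)) ≤ r * e := by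
    have := neg_abs_le (r * e)
    rw [abs_mul] at this
    nlinarith [mul_le_mul_of_nonneg_left habs (abs_nonneg r)]
  have hlhs : 2 * ε * p ^ 3 * (a ^ 2 + b ^ 2) =
      2 * (ε * p) * (r - e) ^ 2 + 2 * (ε * p) * p ^ 2 * b ^ 2 := by
    rw [← hpa]; ring
  rw [hlhs, ← hr]
  have h1 := mul_le_mul_of_nonneg_left hre hεp.le
  have h2 := mul_le_mul_of_nonneg_left he hεp.le
  have h3 := sq_nonneg (s * |r| - 2 * (ε * p) * b)
  have h4 := sq_nonneg (p * r)
  have h5 := sq_abs r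
  have h6 : (s * |r|) ^ 2 = s ^ 2 * r ^ 2 := by rw [mul_pow, h5]
  nlinarith

section Potential

variable {n : ℕ}

/-- The gradient of `-2 l`. -/
def gradNegTwoL (x : EuclideanSpace ℝ (Fin n)) (ε : ℝ) (y : EuclideanSpace ℝ (Fin n)) :
    EuclideanSpace ℝ (Fin n) :=
  -(lFun x ε y)⁻¹ • (x - ε • (‖y‖⁻¹ • y))

/-- The Hessian of `-2 l` at `y`, applied to `h`. -/
def hessNegTwoL (x : EuclideanSpace ℝ (Fin n)) (ε : ℝ) (y h : EuclideanSpace ℝ (Fin n)) :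
    EuclideanSpace ℝ (Fin n) :=
  (2 * lFun x ε y ^ 3)⁻¹ •
    (⟪x - ε • (‖y‖⁻¹ • y), h⟫ • (x - ε • (‖y‖⁻¹ • y)) +
      (2 * ε * (⟪‖y‖⁻¹ • y, x⟫ - ε)) • (h - ⟪‖y‖⁻¹ • y, h⟫ • (‖y‖⁻¹ • y)))

variable {x y h : EuclideanSpace ℝ (Fin n)} {ε : ℝ}

theorem ne_zero_of_pos (hy : 0 < ⟪y, x⟫ - ε * ‖y‖) : y ≠ 0 := by
  rintro rfl
  simp at hy

theorem lFun_sq (hy : 0 < ⟪y, x⟫ - ε * ‖y‖) :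
    lFun x ε y ^ 2 = ‖y‖ * (⟪‖y‖⁻¹ • y, x⟫ - ε) := by
  have hn : ‖y‖ ≠ 0 := norm_ne_zero_iff.mpr (ne_zero_of_pos hy)
  rw [lFun, Real.sq_sqrt hy.le, real_inner_smul_left]
  field_simp

theorem hasFDerivAt_lFun (hy : 0 < ⟪y, x⟫ - ε * ‖y‖) :
    HasFDerivAt (lFun x ε) ((2 * lFun x ε y)⁻¹ • innerSL ℝ (x - ε • (‖y‖⁻¹ • y))) y := by
  have h1 : HasFDerivAt (fun z => ⟪z, x⟫) (innerSL ℝ x) y := by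
    simp only [real_inner_comm x]
    exact (innerSL ℝ x).hasFDerivAt
  have h2 := (h1.sub ((hasFDerivAt_norm_of_ne_zero (ne_zero_of_pos hy)).const_mul ε)).sqrt hy.ne'
  refine h2.congr_fderiv ?_
  rw [map_sub, map_smul ((innerSL ℝ)) ε, ← one_div (2 * _)]
  rfl

theorem hasGradientAt_neg_two_lFun (hy : 0 < ⟪y, x⟫ - ε * ‖y‖) :
    HasGradientAt (fun z => -2 * lFun x ε z) (gradNegTwoL x ε y) y := by
  rw [hasGradientAt_iff_hasFDerivAt]
  refine ((hasFDerivAt_lFun hy).const_mul (-2)).congr_fderiv ?_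
  ext k
  simp only [gradNegTwoL, InnerProductSpace.toDual_apply_apply, smul_apply,
    innerSL_apply_apply, real_inner_smul_left, smul_eq_mul]
  ring

theorem hasDerivAt_gradNegTwoL {γ : ℝ → EuclideanSpace ℝ (Fin n)} {t : ℝ}
    (hγ : HasDerivAt γ h t) (hy : 0 < ⟪γ t, x⟫ - ε * ‖γ t‖) :
    HasDerivAt (fun s => gradNegTwoL x ε (γ s)) (hessNegTwoL x ε (γ t) h) t := by
  have hn : ‖γ t‖ ≠ 0 := norm_ne_zero_iff.mpr (ne_zero_of_pos hy)
  have hl : lFun x ε (γ t) ≠ 0 := (Real.sqrt_pos.mpr hy).ne'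
  have hL : HasDerivAt (fun s => (lFun x ε (γ s))⁻¹) _ t :=
    ((hasFDerivAt_lFun hy).comp_hasDerivAt t hγ).fun_inv hl
  have hN : HasDerivAt (fun s => ‖γ s‖⁻¹ • γ s) _ t :=
    (((hasFDerivAt_norm_of_ne_zero (ne_zero_of_pos hy)).comp_hasDerivAt t hγ).fun_inv hn).fun_smul
      hγ
  have hsq := lFun_sq hy
  have hc : ⟪‖γ t‖⁻¹ • γ t, x⟫ - ε = lFun x ε (γ t) ^ 2 / ‖γ t‖ := by
    rw [hsq]; field_simp
  refine (hL.fun_neg.fun_smul ((hN.fun_const_smul ε).const_sub x)).congr_deriv ?_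
  rw [hessNegTwoL, hc]
  simp only [Function.comp, innerSL_apply_apply, smul_apply, smul_eq_mul,
    real_inner_smul_left]
  generalize ⟪x - ε • (‖γ t‖⁻¹ • γ t), h⟫ = ρ
  match_scalars <;> field_simp
  ring

theorem norm_inv_norm_smul (hy : y ≠ 0) : ‖‖y‖⁻¹ • y‖ = 1 := by
  rw [norm_smul, norm_inv, norm_norm, inv_mul_cancel₀ (norm_ne_zero_iff.mpr hy)]

theorem norm_sub_smul_sq_s11 {u : EuclideanSpace ℝ (Fin n)} (hu : ‖u‖ = 1) (x) (c : ℝ) :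
    ‖x - c • u‖ ^ 2 = ‖x‖ ^ 2 - 2 * c * ⟪u, x⟫ + c ^ 2 := by
  rw [norm_sub_sq_real, norm_smul, hu, inner_smul_right, real_inner_comm, mul_one, Real.norm_eq_abs,
    sq_abs]
  ring

theorem inner_unit_sub_pos (hy : 0 < ⟪y, x⟫ - ε * ‖y‖) : 0 < ⟪‖y‖⁻¹ • y, x⟫ - ε := by
  have hn : 0 < ‖y‖ := norm_pos_iff.mpr (ne_zero_of_pos hy)
  have hsq := lFun_sq hy
  have hl : 0 < lFun x ε y := Real.sqrt_pos.mpr hy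
  exact pos_of_mul_pos_right (hsq ▸ pow_pos hl 2) hn.le

theorem norm_hessNegTwoL_le (hε : 0 < ε) (hy : 0 < ⟪y, x⟫ - ε * ‖y‖) :
    ‖hessNegTwoL x ε y h‖ ≤ (‖x‖ ^ 2 - ε ^ 2) / (2 * lFun x ε y ^ 3) * ‖h‖ := by
  have hl : 0 < lFun x ε y := Real.sqrt_pos.mpr hy
  have hp := inner_unit_sub_pos hy
  have hu := norm_inv_norm_smul (ne_zero_of_pos hy)
  rw [hessNegTwoL]
  generalize ‖y‖⁻¹ • y = u at *
  have hv := norm_sub_smul_sq_s11 hu x ε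
  have hproj : ‖h - ⟪u, h⟫ • u‖ ≤ ‖h‖ := by
    refine (sq_le_sq₀ (norm_nonneg _) (norm_nonneg _)).mp ?_
    rw [norm_sub_smul_sq_s11 hu]
    nlinarith [sq_nonneg ⟪u, h⟫]
  rw [norm_smul, Real.norm_of_nonneg (by positivity), div_eq_inv_mul,
    mul_assoc (2 * lFun x ε y ^ 3)⁻¹]
  refine mul_le_mul_of_nonneg_left ?_ (by positivity)
  calc _ ≤ ‖⟪x - ε • u, h⟫ • (x - ε • u)‖ + ‖(2 * ε * (⟪u, x⟫ - ε)) • (h - ⟪u, h⟫ • u)‖ :=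
        norm_add_le _ _
    _ ≤ (‖x - ε • u‖ * ‖h‖) * ‖x - ε • u‖ + (2 * ε * (⟪u, x⟫ - ε)) * ‖h‖ := by
        rw [norm_smul, norm_smul, Real.norm_of_nonneg (by positivity : 0 ≤ 2 * ε * (⟪u, x⟫ - ε))]
        gcongr
        exact norm_inner_le_norm _ _
    _ = (‖x‖ ^ 2 - ε ^ 2) * ‖h‖ := by linear_combination ‖h‖ * hv

theorem le_inner_hessNegTwoL (hε : 0 < ε) (hx : ε < ‖x‖) (hy : 0 < ⟪y, x⟫ - ε * ‖y‖) :
    ε / (‖x‖ ^ 2 - ε ^ 2) * (lFun x ε y / ‖y‖) ^ 3 * ‖h‖ ^ 2 ≤ ⟪hessNegTwoL x ε y h, h⟫ := by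
  have hl : 0 < lFun x ε y := Real.sqrt_pos.mpr hy
  have hn : 0 < ‖y‖ := norm_pos_iff.mpr (ne_zero_of_pos hy)
  have hp := inner_unit_sub_pos hy
  have hu := norm_inv_norm_smul (ne_zero_of_pos hy)
  have hsq := lFun_sq hy
  have hT : 0 < ‖x‖ ^ 2 - ε ^ 2 := by nlinarith
  rw [hessNegTwoL]
  generalize ‖y‖⁻¹ • y = u at *
  have hs : 0 ≤ ‖x‖ ^ 2 - ⟪u, x⟫ ^ 2 := by
    nlinarith [norm_sub_smul_sq_s11 hu x ⟪u, x⟫, sq_nonneg ‖x - ⟪u, x⟫ • u‖]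
  have hb : 0 ≤ ‖h‖ ^ 2 - ⟪u, h⟫ ^ 2 := by
    nlinarith [norm_sub_smul_sq_s11 hu h ⟪u, h⟫, sq_nonneg ‖h - ⟪u, h⟫ • u‖]
  have key := rank_two_quadratic_form_lower_bound (a := ⟪u, h⟫) hε hp hs hb
    (inner_sub_smul_sq_le hu x h)
  simp only [inner_add_left, inner_sub_left, real_inner_smul_left, real_inner_self_eq_norm_sq]
  have hlhs : ε / (‖x‖ ^ 2 - ε ^ 2) * (lFun x ε y / ‖y‖) ^ 3 * ‖h‖ ^ 2 =
      (2 * lFun x ε y ^ 3)⁻¹ *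
        (2 * ε * (⟪u, x⟫ - ε) ^ 3 * ‖h‖ ^ 2 / (‖x‖ ^ 2 - ε ^ 2)) := by
    have hpe : ⟪u, x⟫ - ε = lFun x ε y ^ 2 / ‖y‖ := by rw [hsq]; field_simp
    rw [hpe]
    field_simp
  rw [hlhs]
  refine mul_le_mul_of_nonneg_left ?_ (by positivity)
  rw [div_le_iff₀ hT]
  linear_combination key

theorem mem_LamBar_iff {ηbar B : ℝ} (hη : 0 < ηbar) :
    y ∈ LamBar x ε ηbar B ↔ ηbar ^ 2 ≤ ⟪y, x⟫ - ε * ‖y‖ ∧ ‖y‖ ≤ B := by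
  simp only [LamBar, lFun, mem_ofPred_eq, Real.le_sqrt' hη]
  exact ⟨fun hy => hy.2, fun hy => ⟨(pow_pos hη 2).trans_le hy.1, hy⟩⟩

theorem convex_LamBar {ηbar B : ℝ} (hε : 0 < ε) (hη : 0 < ηbar) :
    Convex ℝ (LamBar x ε ηbar B) := by
  intro y hy z hz a b ha hb hab
  rw [mem_LamBar_iff hη] at *
  have hnorm : ‖a • y + b • z‖ ≤ a * ‖y‖ + b * ‖z‖ := by
    refine (norm_add_le _ _).trans_eq ?_
    rw [norm_smul, norm_smul, Real.norm_of_nonneg ha, Real.norm_of_nonneg hb]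
  rw [inner_add_left, real_inner_smul_left, real_inner_smul_left]
  obtain rfl : b = 1 - a := by linarith
  constructor
  · nlinarith [mul_le_mul_of_nonneg_left hnorm hε.le, mul_le_mul_of_nonneg_left hy.1 ha,
      mul_le_mul_of_nonneg_left hz.1 hb]
  · nlinarith [mul_le_mul_of_nonneg_left hy.2 ha, mul_le_mul_of_nonneg_left hz.2 hb]

end Potential

/- STATEMENT 11: on `Λ̄(η̄, B)`, the map `λ ↦ -2 l(λ)` is `α'`-strongly convex and
`β'`-smooth, with `α' = (ε/(‖x‖² - ε²))(η̄/B)³` and `β' = (‖x‖² - ε²)/(2 η̄³)`. -/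
theorem stmt11 {n : ℕ} (x : EuclideanSpace ℝ (Fin n)) (ε : ℝ)
    (hε : 0 < ε) (hx : ε < ‖x‖)
    (ηbar B : ℝ) (hηbar : 0 < ηbar) (hB : 0 < B) :
    (∀ lam ∈ LamBar x ε ηbar B, ∀ mu ∈ LamBar x ε ηbar B,
      -2 * lFun x ε mu ≥
        -2 * lFun x ε lam +
          ⟪gradient (fun l : EuclideanSpace ℝ (Fin n) => -2 * lFun x ε l) lam, mu - lam⟫ +
          (ε / (‖x‖ ^ 2 - ε ^ 2) * (ηbar / B) ^ 3) / 2 * ‖mu - lam‖ ^ 2) ∧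
    (∀ lam ∈ LamBar x ε ηbar B, ∀ mu ∈ LamBar x ε ηbar B,
      ‖gradient (fun l : EuclideanSpace ℝ (Fin n) => -2 * lFun x ε l) lam -
          gradient (fun l : EuclideanSpace ℝ (Fin n) => -2 * lFun x ε l) mu‖ ≤
        (‖x‖ ^ 2 - ε ^ 2) / (2 * ηbar ^ 3) * ‖lam - mu‖) := by
  have hT : 0 < ‖x‖ ^ 2 - ε ^ 2 := by nlinarith
  have hline : ∀ (lam mu : EuclideanSpace ℝ (Fin n)) (t : ℝ),
      HasDerivAt (fun s : ℝ => lam + s • (mu - lam)) (mu - lam) t := fun lam mu t => by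
    simpa using ((hasDerivAt_id t).smul_const (mu - lam)).const_add lam
  have hmem : ∀ lam ∈ LamBar x ε ηbar B, ∀ mu ∈ LamBar x ε ηbar B, ∀ t ∈ Icc (0 : ℝ) 1,
      lam + t • (mu - lam) ∈ LamBar x ε ηbar B := fun lam hlam mu hmu t ht =>
    (convex_LamBar hε hηbar).add_smul_sub_mem hlam hmu ht
  constructor
  · intro lam hlam mu hmu
    have h := add_deriv_add_half_le_of_le_second_deriv
      (f := fun t => -2 * lFun x ε (lam + t • (mu - lam)))
      (f' := fun t => ⟪gradNegTwoL x ε (lam + t • (mu - lam)), mu - lam⟫)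
      (f'' := fun t => ⟪hessNegTwoL x ε (lam + t • (mu - lam)) (mu - lam), mu - lam⟫)
      (A := ε / (‖x‖ ^ 2 - ε ^ 2) * (ηbar / B) ^ 3 * ‖mu - lam‖ ^ 2)
      (fun t ht =>
        HasFDerivAt.comp_hasDerivAt (f := fun s : ℝ => lam + s • (mu - lam)) t
          (hasGradientAt_neg_two_lFun (hmem lam hlam mu hmu t ht).1).hasFDerivAt (hline lam mu t))
      (fun t ht => by
        simpa using (hasDerivAt_gradNegTwoL (hline lam mu t)
          (hmem lam hlam mu hmu t ht).1).inner ℝ (hasDerivAt_const t (mu - lam)))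
      (fun t ht => by
        obtain ⟨hpos, hl, hn⟩ := hmem lam hlam mu hmu t ht
        refine le_trans ?_ (le_inner_hessNegTwoL hε hx hpos)
        have := norm_pos_iff.mpr (ne_zero_of_pos hpos)
        have := hηbar.trans_le hl
        gcongr)
    simp only [zero_smul, add_zero, one_smul, add_sub_cancel] at h
    rw [(hasGradientAt_neg_two_lFun hlam.1).gradient]
    linarith
  · intro lam hlam mu hmu
    rw [(hasGradientAt_neg_two_lFun hlam.1).gradient, (hasGradientAt_neg_two_lFun hmu.1).gradient]
    have h := norm_image_sub_le_of_norm_deriv_le_segment_01'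
      (f := fun t : ℝ => gradNegTwoL x ε (mu + t • (lam - mu)))
      (f' := fun t => hessNegTwoL x ε (mu + t • (lam - mu)) (lam - mu))
      (C := (‖x‖ ^ 2 - ε ^ 2) / (2 * ηbar ^ 3) * ‖lam - mu‖)
      (fun t ht => (hasDerivAt_gradNegTwoL (hline mu lam t)
        (hmem mu hmu lam hlam t ht).1).hasDerivWithinAt)
      (fun t ht => by
        obtain ⟨hpos, hl, -⟩ := hmem mu hmu lam hlam t (Ico_subset_Icc_self ht)
        refine (norm_hessNegTwoL_le hε hpos).trans ?_
        gcongr)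
    simpa using h
end
end

section
/- For every h ∈ K(ε), the supremum over λ ∈ Λ of L(λ, h) = 2·√(⟨λ, x⟩ − ε‖λ‖) − ⟨λ, φ(h)⟩ is finite and equals η(h) = (‖x‖² − ε²)/(⟨x, φ(h)⟩ + ‖φ(h)‖·√(ε² − e(h))). -/
open scoped RealInnerProductSpace

noncomputable section

/- The dual cone `Λ = {λ : ⟨λ, x⟩ - ε‖λ‖ > 0}`. -/
def LamSet {n : ℕ} (x : EuclideanSpace ℝ (Fin n)) (ε : ℝ) :
    Set (EuclideanSpace ℝ (Fin n)) :=
  {lam | 0 < ⟪lam, x⟫ - ε * ‖lam‖}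

/- `L(λ, h) = 2 l(λ) - ⟨λ, φ(h)⟩`. -/
def LFun {H : Type*} [NormedAddCommGroup H] [InnerProductSpace ℝ H] {n : ℕ}
    (φ : H →ₗ[ℝ] EuclideanSpace ℝ (Fin n)) (x : EuclideanSpace ℝ (Fin n)) (ε : ℝ)
    (lam : EuclideanSpace ℝ (Fin n)) (h : H) : ℝ :=
  2 * lFun x ε lam - ⟪lam, φ h⟫

section Auxiliary

variable {E : Type*} [NormedAddCommGroup E] [InnerProductSpace ℝ E]

/-- If `θ • v` lies in the closed `ε`-ball around `x`, then `θ` bounds the dual objective. -/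
theorem two_mul_sqrt_sub_inner_le {x v lam : E} {ε θ : ℝ} (hθ : 0 < θ)
    (hdist : ‖x - θ • v‖ ≤ ε) (hlam : 0 < ⟪lam, x⟫ - ε * ‖lam‖) :
    2 * Real.sqrt (⟪lam, x⟫ - ε * ‖lam‖) - ⟪lam, v⟫ ≤ θ := by
  have hcs : ⟪lam, x - θ • v⟫ ≤ ε * ‖lam‖ := by
    calc ⟪lam, x - θ • v⟫ ≤ ‖lam‖ * ‖x - θ • v‖ := real_inner_le_norm _ _
      _ ≤ ‖lam‖ * ε := by gcongr
      _ = ε * ‖lam‖ := mul_comm _ _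
  rw [inner_sub_right, real_inner_smul_right] at hcs
  have ht : 0 < ⟪lam, v⟫ := pos_of_mul_pos_right (a := θ) (by linarith) hθ.le
  have hsqrt : Real.sqrt (⟪lam, x⟫ - ε * ‖lam‖) ≤ (θ + ⟪lam, v⟫) / 2 := by
    apply Real.sqrt_le_iff.mpr
    constructor
    · positivity
    · nlinarith [sq_nonneg (θ - ⟪lam, v⟫)]
  linarith

/-- If `θ • v` lies on the sphere of radius `ε` around `x` and the residual `x - θ • v` is not
orthogonal to `v`, then a multiple of the residual attains the value `θ`. -/
theorem exists_dual_eq {x v : E} {ε θ : ℝ} (hθ : 0 < θ) (hdist : ‖x - θ • v‖ = ε)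
    (hpos : 0 < ⟪x - θ • v, v⟫) :
    ∃ lam : E, 0 < ⟪lam, x⟫ - ε * ‖lam‖ ∧
      2 * Real.sqrt (⟪lam, x⟫ - ε * ‖lam‖) - ⟪lam, v⟫ = θ := by
  set u := x - θ • v with hu
  have hx : x = u + θ • v := by rw [hu]; abel
  have hc : 0 < θ / ⟪u, v⟫ := div_pos hθ hpos
  have hinner : ⟪(θ / ⟪u, v⟫) • u, v⟫ = θ := by
    rw [real_inner_smul_left]; field_simp
  have hval : ⟪(θ / ⟪u, v⟫) • u, x⟫ - ε * ‖(θ / ⟪u, v⟫) • u‖ = θ ^ 2 := by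
    have hnorm : ‖(θ / ⟪u, v⟫) • u‖ = θ / ⟪u, v⟫ * ε := by
      rw [norm_smul, Real.norm_of_nonneg hc.le, hdist]
    have hself : ⟪(θ / ⟪u, v⟫) • u, u⟫ = θ / ⟪u, v⟫ * ε ^ 2 := by
      rw [real_inner_smul_left, real_inner_self_eq_norm_sq, hdist]
    rw [hnorm]
    conv_lhs => rw [hx, inner_add_right, real_inner_smul_right _ v, hinner, hself]
    ring
  refine ⟨(θ / ⟪u, v⟫) • u, ?_, ?_⟩
  · rw [hval]; positivity
  · rw [hval, hinner, Real.sqrt_sq hθ.le]; ring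

/-- If `θ • v` lies on the sphere of radius `ε` around `x` and the residual `x - θ • v` is
orthogonal to `v`, then the dual objective takes values arbitrarily close to `θ`. -/
theorem exists_dual_ge_of_orthogonal {x v : E} {ε θ γ : ℝ} (hε : 0 < ε) (hv : v ≠ 0)
    (hdist : ‖x - θ • v‖ = ε) (horth : ⟪x - θ • v, v⟫ = 0) (hγ : 0 < γ) (hγθ : γ < θ) :
    ∃ lam : E, 0 < ⟪lam, x⟫ - ε * ‖lam‖ ∧
      2 * γ - θ ≤ 2 * Real.sqrt (⟪lam, x⟫ - ε * ‖lam‖) - ⟪lam, v⟫ := by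
  set u := x - θ • v with hu
  have hx : x = u + θ • v := by rw [hu]; abel
  have hv' : 0 < ‖v‖ := norm_pos_iff.mpr hv
  have hθ : 0 < θ := hγ.trans hγθ
  have hgap : 0 < θ ^ 2 - γ ^ 2 := by nlinarith
  set q := θ ^ 2 / ‖v‖ ^ 2 with hq
  have hq0 : 0 < q := by positivity
  set α := q / (2 * (θ ^ 2 - γ ^ 2)) with hα
  have hα0 : 0 < α := by positivity
  have hαq : 2 * α * (θ ^ 2 - γ ^ 2) = q := by rw [hα]; field_simp
  set lam := α • u + (θ / ‖v‖ ^ 2) • v with hlam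
  have hinner_v : ⟪lam, v⟫ = θ := by
    rw [hlam, inner_add_left, real_inner_smul_left, real_inner_smul_left, horth,
      real_inner_self_eq_norm_sq]
    field_simp
    ring
  have hinner_u : ⟪lam, u⟫ = α * ε ^ 2 := by
    rw [hlam, inner_add_left, real_inner_smul_left, real_inner_smul_left, real_inner_comm u v, horth,
      real_inner_self_eq_norm_sq, hdist]
    ring
  have hinner_x : ⟪lam, x⟫ = α * ε ^ 2 + θ ^ 2 := by
    conv_lhs => rw [hx, inner_add_right, real_inner_smul_right, hinner_u, hinner_v]
    ring
  have hnorm_sq : ‖lam‖ ^ 2 = α ^ 2 * ε ^ 2 + q := by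
    rw [← real_inner_self_eq_norm_sq]
    conv_lhs =>
      rw [hlam, inner_add_right, real_inner_smul_right, real_inner_smul_right, ← hlam,
        hinner_u, hinner_v]
    rw [hq]
    ring
  have hnorm : ε * ‖lam‖ ≤ α * ε ^ 2 + (θ ^ 2 - γ ^ 2) := by
    refine abs_le_of_sq_le_sq' ?_ (by positivity) |>.2
    rw [mul_pow, hnorm_sq, ← hαq]
    nlinarith [sq_nonneg (θ ^ 2 - γ ^ 2)]
  have hval : γ ^ 2 ≤ ⟪lam, x⟫ - ε * ‖lam‖ := by linarith
  refine ⟨lam, (by positivity : 0 < γ ^ 2).trans_le hval, ?_⟩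
  have := Real.le_sqrt_of_sq_le hval
  linarith

end Auxiliary

/- STATEMENT 12: for every `h ∈ K(ε)` the supremum of `L(·, h)` over `Λ` is finite
and equals `η(h)`. -/
theorem stmt12 {H : Type*} [NormedAddCommGroup H] [InnerProductSpace ℝ H]
    [FiniteDimensional ℝ H] {n : ℕ}
    (φ : H →ₗ[ℝ] EuclideanSpace ℝ (Fin n)) (x : EuclideanSpace ℝ (Fin n))
    (ε : ℝ) (hε : 0 < ε) (hx : ε < ‖x‖) :
    ∀ h ∈ Kcone φ x ε,
      IsLUB ((fun lam => LFun φ x ε lam h) '' LamSet x ε) (etaFun φ x ε h) := by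
  rintro h ⟨ha, he⟩
  have hv : φ h ≠ 0 := by
    intro h0
    simp [h0] at ha
  have heq : eFun φ x h = ‖x‖ ^ 2 - ⟪x, φ h⟫ ^ 2 / ‖φ h‖ ^ 2 := by simp [eFun, hv]
  set v := φ h with hvdef
  have hv' : 0 < ‖v‖ := norm_pos_iff.mpr hv
  set s := Real.sqrt (ε ^ 2 - eFun φ x h) with hs
  have hs0 : 0 ≤ s := Real.sqrt_nonneg _
  have hs_sq : (‖v‖ * s) ^ 2 = ⟪x, v⟫ ^ 2 - ‖v‖ ^ 2 * (‖x‖ ^ 2 - ε ^ 2) := by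
    rw [mul_pow, hs, Real.sq_sqrt (by linarith), heq]
    field_simp
    ring
  have hD : 0 < ⟪x, v⟫ + ‖v‖ * s := by positivity
  have hnum : 0 < ‖x‖ ^ 2 - ε ^ 2 := by nlinarith
  set θ := etaFun φ x ε h with hθdef
  have hθD : θ * (⟪x, v⟫ + ‖v‖ * s) = ‖x‖ ^ 2 - ε ^ 2 := div_mul_cancel₀ _ hD.ne'
  have hθ : 0 < θ := div_pos hnum hD
  have hθv : θ * ‖v‖ ^ 2 = ⟪x, v⟫ - ‖v‖ * s := by
    apply mul_right_cancel₀ hD.ne'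
    linear_combination ‖v‖ ^ 2 * hθD + hs_sq
  have hinner : ⟪x - θ • v, v⟫ = ‖v‖ * s := by
    rw [inner_sub_left, real_inner_smul_left, real_inner_self_eq_norm_sq]
    linarith
  have hdist : ‖x - θ • v‖ = ε := by
    rw [← sq_eq_sq₀ (norm_nonneg _) hε.le, norm_sub_sq_real, real_inner_smul_right, norm_smul,
      mul_pow, Real.norm_eq_abs, sq_abs]
    linear_combination θ * hθv - hθD
  constructor
  · rintro _ ⟨lam, hlam, rfl⟩
    exact two_mul_sqrt_sub_inner_le hθ hdist.le hlam
  · intro b hb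
    rcases hs0.eq_or_lt with hs0 | hs0
    · by_contra! hlt
      obtain ⟨γ, hγ, hγθ⟩ := exists_between
        (max_lt hθ (by linarith : (b + θ) / 2 < θ))
      obtain ⟨hγ0, hγb⟩ := max_lt_iff.mp hγ
      obtain ⟨lam, hlam, hle⟩ := exists_dual_ge_of_orthogonal hε hv hdist
        (by rw [hinner, ← hs0, mul_zero]) hγ0 hγθ
      have hLb : 2 * Real.sqrt (⟪lam, x⟫ - ε * ‖lam‖) - ⟪lam, v⟫ ≤ b := hb ⟨lam, hlam, rfl⟩
      linarith
    · obtain ⟨lam, hlam, hL⟩ := exists_dual_eq hθ hdist (by rw [hinner]; positivity)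
      exact hb ⟨lam, hlam, hL⟩
end
end

section
/- For every h ∈ H with h ∉ K(ε), the maximization problem sup over λ ∈ Λ of L(λ, h) = 2·√(⟨λ, x⟩ − ε‖λ‖) − ⟨λ, φ(h)⟩ is unbounded (the supremum equals +∞). -/
open scoped RealInnerProductSpace

noncomputable section

theorem lFun_sq_smul {n : ℕ} (x : EuclideanSpace ℝ (Fin n)) (ε : ℝ)
    (lam : EuclideanSpace ℝ (Fin n)) {s : ℝ} (hs : 0 ≤ s) :
    lFun x ε (s ^ 2 • lam) = s * lFun x ε lam := by
  have h : ⟪s ^ 2 • lam, x⟫ - ε * ‖s ^ 2 • lam‖ = s ^ 2 * (⟪lam, x⟫ - ε * ‖lam‖) := by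
    rw [real_inner_smul_left, norm_smul, Real.norm_of_nonneg (sq_nonneg s)]
    ring
  rw [lFun, lFun, h, Real.sqrt_mul (sq_nonneg s), Real.sqrt_sq hs]

theorem smul_mem_LamSet {n : ℕ} {x : EuclideanSpace ℝ (Fin n)} {ε : ℝ}
    {lam : EuclideanSpace ℝ (Fin n)} (hlam : lam ∈ LamSet x ε) {t : ℝ} (ht : 0 < t) :
    t • lam ∈ LamSet x ε := by
  have h : ⟪t • lam, x⟫ - ε * ‖t • lam‖ = t * (⟪lam, x⟫ - ε * ‖lam‖) := by
    rw [real_inner_smul_left, norm_smul, Real.norm_of_nonneg ht.le]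
    ring
  change 0 < ⟪t • lam, x⟫ - ε * ‖t • lam‖
  rw [h]
  exact mul_pos ht hlam

/-- A direction of the dual cone with nonpositive pairing against `φ h` is a direction of
unbounded increase of `L(·, h)`. -/
theorem not_bddAbove_LFun_of_inner_nonpos {H : Type*} [NormedAddCommGroup H]
    [InnerProductSpace ℝ H] {n : ℕ} (φ : H →ₗ[ℝ] EuclideanSpace ℝ (Fin n))
    {x : EuclideanSpace ℝ (Fin n)} {ε : ℝ} {h : H} {lam : EuclideanSpace ℝ (Fin n)}
    (hlam : lam ∈ LamSet x ε) (hle : ⟪lam, φ h⟫ ≤ 0) :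
    ¬ BddAbove ((fun lam => LFun φ x ε lam h) '' LamSet x ε) := by
  rintro ⟨M, hM⟩
  have hl : 0 < lFun x ε lam := Real.sqrt_pos.2 hlam
  set s := (|M| + 1) / lFun x ε lam
  have hs : 0 < s := by positivity
  have hsl : s * lFun x ε lam = |M| + 1 := div_mul_cancel₀ _ hl.ne'
  have hbound : LFun φ x ε (s ^ 2 • lam) h ≤ M :=
    hM ⟨_, smul_mem_LamSet hlam (pow_pos hs 2), rfl⟩
  rw [LFun, lFun_sq_smul x ε lam hs.le, hsl, real_inner_smul_left] at hbound
  have := mul_nonpos_of_nonneg_of_nonpos (sq_nonneg s) hle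
  linarith [le_abs_self M, abs_nonneg M]

/- STATEMENT 13: for every `h ∉ K(ε)` the supremum of `L(·, h)` over `Λ` is `+∞`. -/
theorem stmt13 {H : Type*} [NormedAddCommGroup H] [InnerProductSpace ℝ H]
    [FiniteDimensional ℝ H] {n : ℕ}
    (φ : H →ₗ[ℝ] EuclideanSpace ℝ (Fin n)) (x : EuclideanSpace ℝ (Fin n))
    (ε : ℝ) (hε : 0 < ε) (hx : ε < ‖x‖) :
    ∀ h : H, h ∉ Kcone φ x ε →
      ¬ BddAbove ((fun lam => LFun φ x ε lam h) '' LamSet x ε) := by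
  intro h hh
  rcases le_or_gt ⟪x, φ h⟫ 0 with hxy | hxy
  · refine not_bddAbove_LFun_of_inner_nonpos φ (lam := x) ?_ hxy
    change 0 < ⟪x, x⟫ - ε * ‖x‖
    rw [real_inner_self_eq_norm_sq]
    nlinarith
  · have hy : φ h ≠ 0 := by
      intro h0
      simp [h0] at hxy
    have he : ε ^ 2 < ‖x‖ ^ 2 - ⟪x, φ h⟫ ^ 2 / ‖φ h‖ ^ 2 := by
      have : ε ^ 2 < eFun φ x h := not_le.1 fun hle => hh ⟨hxy, hle⟩
      rwa [eFun, if_neg hy] at this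
    have hn : ‖φ h‖ ≠ 0 := norm_ne_zero_iff.2 hy
    set c := ⟪x, φ h⟫ / ‖φ h‖ ^ 2 with hc
    -- The residual of the orthogonal projection of `x` onto the line through `φ h`.
    have horth : ⟪x - c • φ h, φ h⟫ = 0 := by
      rw [inner_sub_left, real_inner_smul_left, real_inner_self_eq_norm_sq, hc]
      field_simp
      ring
    have hinner : ⟪x - c • φ h, x⟫ = ‖x‖ ^ 2 - ⟪x, φ h⟫ ^ 2 / ‖φ h‖ ^ 2 := by
      rw [inner_sub_left, real_inner_smul_left, real_inner_self_eq_norm_sq,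
        real_inner_comm, hc]
      ring
    have hnorm : ‖x - c • φ h‖ ^ 2 = ⟪x - c • φ h, x⟫ := by
      rw [← real_inner_self_eq_norm_sq, inner_sub_right, real_inner_smul_right, horth]
      ring
    refine not_bddAbove_LFun_of_inner_nonpos φ (lam := x - c • φ h) ?_ horth.le
    have hlt : ε < ‖x - c • φ h‖ := by
      refine lt_of_pow_lt_pow_left₀ 2 (norm_nonneg _) ?_
      rwa [hnorm, hinner]
    change 0 < ⟪x - c • φ h, x⟫ - ε * ‖x - c • φ h‖
    rw [← hnorm]
    nlinarith
end
end

section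
/- For h ∈ H, the maximization problem sup over λ ∈ Λ of L(λ, h) = 2·√(⟨λ, x⟩ − ε‖λ‖) − ⟨λ, φ(h)⟩ admits a (unique) maximizer if and only if h lies in the interior of K(ε), i.e. ⟨x, φ(h)⟩ > 0 and e(h) < ε²; in that case the unique maximizer is λ(h) = (η(h)/(‖φ(h)‖·√(ε² − e(h))))·(x − η(h)·φ(h)). -/
open scoped RealInnerProductSpace

noncomputable section

/- The maximizer `λ(h) = (η(h)/(‖φ h‖ √(ε² - e(h)))) • (x - η(h) • φ h)`. -/
def lamFun {H : Type*} [NormedAddCommGroup H] [InnerProductSpace ℝ H] {n : ℕ}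
    (φ : H →ₗ[ℝ] EuclideanSpace ℝ (Fin n)) (x : EuclideanSpace ℝ (Fin n)) (ε : ℝ)
    (h : H) : EuclideanSpace ℝ (Fin n) :=
  (etaFun φ x ε h / (‖φ h‖ * Real.sqrt (ε ^ 2 - eFun φ x h))) •
    (x - etaFun φ x ε h • φ h)

section Maximizer

variable {E : Type*} [NormedAddCommGroup E] [InnerProductSpace ℝ E]

/-- The first-order condition at a maximizer of `2 √(⟨λ, x⟩ - ε‖λ‖) - ⟨λ, y⟩` over the open cone
where the radicand is positive. -/
theorem first_order_condition_of_isMaxOn {x y lam : E} {ε : ℝ}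
    (hlam : 0 < ⟪lam, x⟫ - ε * ‖lam‖)
    (hmax : ∀ mu : E, 0 < ⟪mu, x⟫ - ε * ‖mu‖ →
      2 * √(⟪mu, x⟫ - ε * ‖mu‖) - ⟪mu, y⟫ ≤ 2 * √(⟪lam, x⟫ - ε * ‖lam‖) - ⟪lam, y⟫) :
    x - √(⟪lam, x⟫ - ε * ‖lam‖) • y = (ε / ‖lam‖) • lam := by
  have hlam0 : lam ≠ 0 := by
    rintro rfl
    simp at hlam
  have hnorm : 0 < ‖lam‖ := norm_pos_iff.mpr hlam0
  have hl : 0 < √(⟪lam, x⟫ - ε * ‖lam‖) := Real.sqrt_pos.mpr hlam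
  refine ext_inner_left ℝ fun v => ?_
  have hline : HasDerivAt (fun t : ℝ => lam + t • v) v 0 := by
    simpa using ((hasDerivAt_id (0 : ℝ)).smul_const v).const_add lam
  have hinner (z : E) : HasDerivAt (fun t : ℝ => ⟪lam + t • v, z⟫) ⟪v, z⟫ 0 := by
    simpa using hline.inner ℝ (hasDerivAt_const (0 : ℝ) z)
  have hnormDeriv : HasDerivAt (fun t : ℝ => ‖lam + t • v‖) (⟪lam, v⟫ / ‖lam‖) 0 := by
    have h := hline.norm_sq.sqrt (by simpa using hlam0)
    simp only [Real.sqrt_sq (norm_nonneg _), zero_smul, add_zero] at h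
    convert h using 1
    field_simp
  have hrad : HasDerivAt (fun t : ℝ => ⟪lam + t • v, x⟫ - ε * ‖lam + t • v‖)
      (⟪v, x⟫ - ε * (⟪lam, v⟫ / ‖lam‖)) 0 :=
    (hinner x).sub (hnormDeriv.const_mul ε)
  have hobj := ((hrad.sqrt (by simpa using hlam.ne')).const_mul 2).sub (hinner y)
  have hloc : IsLocalMax (fun t : ℝ =>
      2 * √(⟪lam + t • v, x⟫ - ε * ‖lam + t • v‖) - ⟪lam + t • v, y⟫) 0 := by
    have hpos : ∀ᶠ t : ℝ in nhds 0, 0 < ⟪lam + t • v, x⟫ - ε * ‖lam + t • v‖ :=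
      hrad.continuousAt.eventually (lt_mem_nhds (by simpa using hlam))
    filter_upwards [hpos] with t ht
    simpa using hmax _ ht
  have hzero := hloc.hasDerivAt_eq_zero hobj
  simp only [zero_smul, add_zero] at hzero
  rw [inner_sub_right, inner_smul_right, inner_smul_right, real_inner_comm lam v]
  field_simp at hzero ⊢
  linarith

/-- If `‖x - η y‖ = ε` with `η > 0`, then `2 √(⟨λ, x⟩ - ε‖λ‖) - ⟨λ, y⟩ ≤ η`. -/
theorem two_mul_sqrt_sub_inner_le_s14 {x y lam : E} {ε η : ℝ} (hη : 0 < η)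
    (hnorm : ‖x - η • y‖ = ε) (hlam : 0 < ⟪lam, x⟫ - ε * ‖lam‖) :
    2 * √(⟪lam, x⟫ - ε * ‖lam‖) - ⟪lam, y⟫ ≤ η := by
  have hcs := real_inner_le_norm lam (x - η • y)
  rw [hnorm, inner_sub_right, inner_smul_right] at hcs
  have hsq := Real.sq_sqrt hlam.le
  set l := √(⟪lam, x⟫ - ε * ‖lam‖)
  refine le_of_mul_le_mul_left ?_ hη
  nlinarith [sq_nonneg (l - η)]

/-- The equality case of `two_mul_sqrt_sub_inner_le`. -/
theorem eq_smul_of_le_two_mul_sqrt_sub_inner {x y lam : E} {ε η r : ℝ} (hε : 0 < ε) (hη : 0 < η)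
    (hr : 0 < r) (hnorm : ‖x - η • y‖ = ε) (hrad : ⟪x - η • y, x⟫ - ε ^ 2 = η * r)
    (hlam : 0 < ⟪lam, x⟫ - ε * ‖lam‖)
    (hle : η ≤ 2 * √(⟪lam, x⟫ - ε * ‖lam‖) - ⟪lam, y⟫) :
    lam = (η / r) • (x - η • y) := by
  have hcs := real_inner_le_norm lam (x - η • y)
  have hexp : ⟪lam, x - η • y⟫ = ⟪lam, x⟫ - η * ⟪lam, y⟫ := by
    rw [inner_sub_right, inner_smul_right]
  have hsq := Real.sq_sqrt hlam.le
  set l := √(⟪lam, x⟫ - ε * ‖lam‖)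
  have hmul := mul_le_mul_of_nonneg_left hle hη.le
  rw [hnorm] at hcs
  have hlη : l = η := by
    have : (l - η) ^ 2 = 0 := le_antisymm (by nlinarith) (sq_nonneg _)
    exact sub_eq_zero.mp (pow_eq_zero_iff two_ne_zero |>.mp this)
  have heq : ⟪lam, x - η • y⟫ = ‖lam‖ * ‖x - η • y‖ := by
    rw [hnorm]
    nlinarith
  have hpar := inner_eq_norm_mul_iff_real.mp heq
  rw [hnorm] at hpar
  obtain ⟨c, hc, rfl⟩ : ∃ c : ℝ, 0 ≤ c ∧ lam = c • (x - η • y) := by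
    refine ⟨‖lam‖ / ε, by positivity, ?_⟩
    rw [div_eq_inv_mul, mul_smul, ← hpar, smul_smul, inv_mul_cancel₀ hε.ne', one_smul]
  rw [real_inner_smul_left, norm_smul, Real.norm_of_nonneg hc, hnorm, hlη] at hsq
  have hcr : c * r = η := mul_left_cancel₀ hη.ne' (by linear_combination -hsq - c * hrad)
  rw [← hcr, mul_div_cancel_right₀ _ hr.ne']

end Maximizer

section Formula

variable {H : Type*} [NormedAddCommGroup H] [InnerProductSpace ℝ H] {n : ℕ}
  {φ : H →ₗ[ℝ] EuclideanSpace ℝ (Fin n)} {x : EuclideanSpace ℝ (Fin n)} {ε : ℝ} {h : H}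

theorem norm_sq_mul_eFun (hh : φ h ≠ 0) :
    ‖φ h‖ ^ 2 * eFun φ x h = ‖φ h‖ ^ 2 * ‖x‖ ^ 2 - ⟪x, φ h⟫ ^ 2 := by
  have : ‖φ h‖ ≠ 0 := norm_ne_zero_iff.mpr hh
  rw [eFun, if_neg hh]
  field_simp

theorem map_ne_zero_of_inner_pos (hp : 0 < ⟪x, φ h⟫) : φ h ≠ 0 := by
  intro h0
  simp [h0] at hp

theorem norm_mul_sqrt_pos (hp : 0 < ⟪x, φ h⟫) (he : eFun φ x h < ε ^ 2) :
    0 < ‖φ h‖ * √(ε ^ 2 - eFun φ x h) :=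
  mul_pos (norm_pos_iff.mpr (map_ne_zero_of_inner_pos hp)) (Real.sqrt_pos.mpr (sub_pos.mpr he))

theorem etaFun_pos_s14 (hε : 0 < ε) (hx : ε < ‖x‖) (hp : 0 < ⟪x, φ h⟫) (he : eFun φ x h < ε ^ 2) :
    0 < etaFun φ x ε h :=
  div_pos (by nlinarith) (add_pos hp (norm_mul_sqrt_pos hp he))

/-- `η(h)` is the smaller root of `‖x - θ φ(h)‖² = ε²`. -/
theorem inner_sub_etaFun_mul (hp : 0 < ⟪x, φ h⟫) (he : eFun φ x h < ε ^ 2) :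
    ⟪x, φ h⟫ - etaFun φ x ε h * ‖φ h‖ ^ 2 = ‖φ h‖ * √(ε ^ 2 - eFun φ x h) := by
  have hr := norm_mul_sqrt_pos hp he
  have hsq := Real.sq_sqrt (sub_pos.mpr he).le
  have hnorm := norm_sq_mul_eFun (x := x) (map_ne_zero_of_inner_pos hp)
  have hsum := (add_pos hp hr).ne'
  rw [etaFun]
  field_simp
  linear_combination hnorm - ‖φ h‖ ^ 2 * hsq

theorem norm_sub_etaFun_smul (hε : 0 < ε) (hp : 0 < ⟪x, φ h⟫) (he : eFun φ x h < ε ^ 2) :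
    ‖x - etaFun φ x ε h • φ h‖ = ε := by
  have hroot := inner_sub_etaFun_mul hp he
  have hden : etaFun φ x ε h * (⟪x, φ h⟫ + ‖φ h‖ * √(ε ^ 2 - eFun φ x h)) = ‖x‖ ^ 2 - ε ^ 2 :=
    div_mul_cancel₀ _ (add_pos hp (norm_mul_sqrt_pos hp he)).ne'
  have hsq : ‖x - etaFun φ x ε h • φ h‖ ^ 2 = ε ^ 2 := by
    rw [norm_sub_sq_real, inner_smul_right, norm_smul, mul_pow, Real.norm_eq_abs, sq_abs]
    linear_combination -hden - etaFun φ x ε h * hroot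
  exact (pow_left_inj₀ (norm_nonneg _) hε.le two_ne_zero).mp hsq

theorem inner_sub_etaFun_smul_sub_sq (hp : 0 < ⟪x, φ h⟫) (he : eFun φ x h < ε ^ 2) :
    ⟪x - etaFun φ x ε h • φ h, x⟫ - ε ^ 2 =
      etaFun φ x ε h * (‖φ h‖ * √(ε ^ 2 - eFun φ x h)) := by
  have hden : etaFun φ x ε h * (⟪x, φ h⟫ + ‖φ h‖ * √(ε ^ 2 - eFun φ x h)) = ‖x‖ ^ 2 - ε ^ 2 :=
    div_mul_cancel₀ _ (add_pos hp (norm_mul_sqrt_pos hp he)).ne'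
  rw [inner_sub_left, real_inner_smul_left, real_inner_self_eq_norm_sq, real_inner_comm x (φ h)]
  linear_combination -hden

theorem inner_lamFun_sub (hε : 0 < ε) (hx : ε < ‖x‖) (hp : 0 < ⟪x, φ h⟫)
    (he : eFun φ x h < ε ^ 2) :
    ⟪lamFun φ x ε h, x⟫ - ε * ‖lamFun φ x ε h‖ = etaFun φ x ε h ^ 2 := by
  have hr := norm_mul_sqrt_pos hp he
  have hη := etaFun_pos_s14 hε hx hp he
  have hrad := inner_sub_etaFun_smul_sub_sq hp he
  rw [lamFun, real_inner_smul_left, norm_smul, norm_sub_etaFun_smul hε hp he,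
    Real.norm_of_nonneg (div_pos hη hr).le]
  generalize ‖φ h‖ * √(ε ^ 2 - eFun φ x h) = r at *
  field_simp
  linear_combination hrad

theorem lamFun_mem_LamSet (hε : 0 < ε) (hx : ε < ‖x‖) (hp : 0 < ⟪x, φ h⟫)
    (he : eFun φ x h < ε ^ 2) : lamFun φ x ε h ∈ LamSet x ε := by
  have hη := etaFun_pos_s14 hε hx hp he
  change 0 < ⟪lamFun φ x ε h, x⟫ - ε * ‖lamFun φ x ε h‖
  rw [inner_lamFun_sub hε hx hp he]
  positivity

/-- The value of the dual objective at `λ(h)` is `η(h)`. -/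
theorem LFun_lamFun (hε : 0 < ε) (hx : ε < ‖x‖) (hp : 0 < ⟪x, φ h⟫)
    (he : eFun φ x h < ε ^ 2) : LFun φ x ε (lamFun φ x ε h) h = etaFun φ x ε h := by
  have hr := norm_mul_sqrt_pos hp he
  have hη := etaFun_pos_s14 hε hx hp he
  have hroot := inner_sub_etaFun_mul hp he
  have hinner : ⟪lamFun φ x ε h, φ h⟫ = etaFun φ x ε h := by
    rw [lamFun, real_inner_smul_left, inner_sub_left, real_inner_smul_left,
      real_inner_self_eq_norm_sq, hroot, div_mul_cancel₀ _ hr.ne']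
  rw [LFun, lFun, inner_lamFun_sub hε hx hp he, Real.sqrt_sq hη.le, hinner]
  ring

theorem isMaxOn_LFun_iff_eq_lamFun (hε : 0 < ε) (hx : ε < ‖x‖) (hp : 0 < ⟪x, φ h⟫)
    (he : eFun φ x h < ε ^ 2) (lam₀ : EuclideanSpace ℝ (Fin n)) :
    (lam₀ ∈ LamSet x ε ∧ ∀ lam ∈ LamSet x ε, LFun φ x ε lam h ≤ LFun φ x ε lam₀ h) ↔
      lam₀ = lamFun φ x ε h := by
  have hη := etaFun_pos_s14 hε hx hp he
  have hnorm := norm_sub_etaFun_smul hε hp he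
  constructor
  · rintro ⟨hmem, hmax⟩
    have hle := hmax _ (lamFun_mem_LamSet hε hx hp he)
    rw [LFun_lamFun hε hx hp he] at hle
    exact eq_smul_of_le_two_mul_sqrt_sub_inner hε hη (norm_mul_sqrt_pos hp he) hnorm
      (inner_sub_etaFun_smul_sub_sq hp he) hmem hle
  · rintro rfl
    refine ⟨lamFun_mem_LamSet hε hx hp he, fun lam hlam => ?_⟩
    rw [LFun_lamFun hε hx hp he]
    exact two_mul_sqrt_sub_inner_le_s14 hη hnorm hlam

theorem inner_pos_and_eFun_lt_of_isMaxOn (hε : 0 < ε) {lam₀ : EuclideanSpace ℝ (Fin n)}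
    (hmem : lam₀ ∈ LamSet x ε)
    (hmax : ∀ lam ∈ LamSet x ε, LFun φ x ε lam h ≤ LFun φ x ε lam₀ h) :
    0 < ⟪x, φ h⟫ ∧ eFun φ x h < ε ^ 2 := by
  have hlam : 0 < ⟪lam₀, x⟫ - ε * ‖lam₀‖ := hmem
  have hfoc := first_order_condition_of_isMaxOn hlam hmax
  have hl : 0 < √(⟪lam₀, x⟫ - ε * ‖lam₀‖) := Real.sqrt_pos.mpr hlam
  have hlam0 : 0 < ‖lam₀‖ := by
    refine norm_pos_iff.mpr ?_
    rintro rfl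
    simp at hlam
  set l := √(⟪lam₀, x⟫ - ε * ‖lam₀‖)
  have hq : l * ⟪lam₀, φ h⟫ = ⟪lam₀, x⟫ - ε * ‖lam₀‖ := by
    have := congrArg (fun z => ⟪lam₀, z⟫) hfoc
    simp only [inner_sub_right, inner_smul_right, real_inner_self_eq_norm_sq] at this
    field_simp at this
    linarith
  have hq0 : 0 < ⟪lam₀, φ h⟫ := pos_of_mul_pos_right (hq ▸ hlam) hl.le
  have hgap : ⟪x, φ h⟫ - l * ‖φ h‖ ^ 2 = ε / ‖lam₀‖ * ⟪lam₀, φ h⟫ := by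
    have := congrArg (fun z => ⟪z, φ h⟫) hfoc
    simpa only [inner_sub_left, real_inner_smul_left, real_inner_self_eq_norm_sq] using this
  have hgap0 : 0 < ⟪x, φ h⟫ - l * ‖φ h‖ ^ 2 := by
    rw [hgap]
    positivity
  have hp : 0 < ⟪x, φ h⟫ := by nlinarith [mul_nonneg hl.le (sq_nonneg ‖φ h‖)]
  refine ⟨hp, ?_⟩
  have hnorm : ‖x‖ ^ 2 - 2 * (l * ⟪x, φ h⟫) + l ^ 2 * ‖φ h‖ ^ 2 = ε ^ 2 := by
    have := congrArg (fun z => ‖z‖ ^ 2) hfoc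
    simp only [norm_sub_sq_real, inner_smul_right, norm_smul, mul_pow, Real.norm_eq_abs, sq_abs,
      div_pow] at this
    rw [this]
    field_simp
  have hh := map_ne_zero_of_inner_pos hp
  have hy : 0 < ‖φ h‖ := norm_pos_iff.mpr hh
  refine lt_of_mul_lt_mul_left ?_ (sq_nonneg ‖φ h‖)
  rw [norm_sq_mul_eFun hh, ← hnorm]
  nlinarith [pow_pos hgap0 2]

end Formula

/- STATEMENT 14: `sup_{λ ∈ Λ} L(λ, h)` admits a (unique) maximizer iff
`h ∈ int K(ε)`, i.e. `⟨x, φ h⟩ > 0` and `e(h) < ε²`; in that case the unique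
maximizer is `λ(h)`. -/
theorem stmt14 {H : Type*} [NormedAddCommGroup H] [InnerProductSpace ℝ H]
    [FiniteDimensional ℝ H] {n : ℕ}
    (φ : H →ₗ[ℝ] EuclideanSpace ℝ (Fin n)) (x : EuclideanSpace ℝ (Fin n))
    (ε : ℝ) (hε : 0 < ε) (hx : ε < ‖x‖) :
    ∀ h : H,
      ((∃ lam₀ ∈ LamSet x ε, ∀ lam ∈ LamSet x ε,
          LFun φ x ε lam h ≤ LFun φ x ε lam₀ h) ↔
        (0 < ⟪x, φ h⟫ ∧ eFun φ x h < ε ^ 2)) ∧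
      ((0 < ⟪x, φ h⟫ ∧ eFun φ x h < ε ^ 2) →
        ∀ lam₀ : EuclideanSpace ℝ (Fin n),
          (lam₀ ∈ LamSet x ε ∧ ∀ lam ∈ LamSet x ε,
              LFun φ x ε lam h ≤ LFun φ x ε lam₀ h) ↔
            lam₀ = lamFun φ x ε h) := by
  intro h
  refine ⟨⟨fun ⟨_, hmem, hmax⟩ => inner_pos_and_eFun_lt_of_isMaxOn hε hmem hmax,
    fun ⟨hp, he⟩ => ⟨lamFun φ x ε h, ?_⟩⟩,
    fun ⟨hp, he⟩ => isMaxOn_LFun_iff_eq_lamFun hε hx hp he⟩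
  exact (isMaxOn_LFun_iff_eq_lamFun hε hx hp he _).mpr rfl
end
end

section
/- For every h ∈ K(ε), the value η(h) satisfies the equation ‖x − η(h)·φ(h)‖ = ε; moreover η(h) is the smallest positive root of the quadratic equation ‖x − θ·φ(h)‖² = ε² in θ, and it admits the alternate expression η(h) = (⟨x, φ(h)⟩ − ‖φ(h)‖·√(ε² − e(h))) / ‖φ(h)‖². -/
open scoped RealInnerProductSpace

noncomputable section

/-- The smaller root of `p θ² - 2 a θ + c`, written as `c / (a + s)` where `s` is the square root of
the reduced discriminant `a² - p c`. -/
theorem isLeast_pos_root_quadratic {p a c s : ℝ} (hp : 0 < p) (ha : 0 < a) (hc : 0 < c)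
    (hs : 0 ≤ s) (hdisc : s ^ 2 = a ^ 2 - p * c) :
    IsLeast {θ : ℝ | 0 < θ ∧ p * θ ^ 2 - 2 * a * θ + c = 0} (c / (a + s)) ∧
      c / (a + s) = (a - s) / p := by
  have has : 0 < a + s := by positivity
  have heq : c / (a + s) = (a - s) / p := by
    rw [div_eq_div_iff has.ne' hp.ne']
    linear_combination hdisc
  refine ⟨⟨⟨by positivity, ?_⟩, fun θ ⟨_, hθ⟩ => ?_⟩, heq⟩
  · rw [heq]
    field_simp
    linear_combination hdisc
  · rw [heq, div_le_iff₀ hp]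
    by_contra! hlt
    have hsq : (a - θ * p) ^ 2 = s ^ 2 := by linear_combination p * hθ - hdisc
    have : s ^ 2 < (a - θ * p) ^ 2 := pow_lt_pow_left₀ (by linarith) hs two_ne_zero
    linarith

/- STATEMENT 16: for every `h ∈ K(ε)`, `‖x - η(h) φ(h)‖ = ε`; moreover `η(h)` is the
smallest positive root of `‖x - θ φ(h)‖² = ε²` and
`η(h) = (⟨x, φ h⟩ - ‖φ h‖ √(ε² - e(h)))/‖φ h‖²`. -/
theorem stmt16 {H : Type*} [NormedAddCommGroup H] [InnerProductSpace ℝ H]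
    [FiniteDimensional ℝ H] {n : ℕ}
    (φ : H →ₗ[ℝ] EuclideanSpace ℝ (Fin n)) (x : EuclideanSpace ℝ (Fin n))
    (ε : ℝ) (hε : 0 < ε) (hx : ε < ‖x‖) :
    ∀ h ∈ Kcone φ x ε,
      ‖x - etaFun φ x ε h • φ h‖ = ε ∧
      IsLeast {θ : ℝ | 0 < θ ∧ ‖x - θ • φ h‖ ^ 2 = ε ^ 2} (etaFun φ x ε h) ∧
      etaFun φ x ε h =
        (⟪x, φ h⟫ - ‖φ h‖ * Real.sqrt (ε ^ 2 - eFun φ x h)) / ‖φ h‖ ^ 2 := by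
  rintro h ⟨ha, he⟩
  have hφ : φ h ≠ 0 := fun h0 => by simp [h0] at ha
  have hb : 0 < ‖φ h‖ := norm_pos_iff.mpr hφ
  have hc : 0 < ‖x‖ ^ 2 - ε ^ 2 := sub_pos.mpr (pow_lt_pow_left₀ hx hε.le two_ne_zero)
  have hdisc : (‖φ h‖ * Real.sqrt (ε ^ 2 - eFun φ x h)) ^ 2 =
      ⟪x, φ h⟫ ^ 2 - ‖φ h‖ ^ 2 * (‖x‖ ^ 2 - ε ^ 2) := by
    rw [mul_pow, Real.sq_sqrt (sub_nonneg.mpr he), eFun, if_neg hφ]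
    field_simp
    ring
  have hroot (θ : ℝ) : ‖x - θ • φ h‖ ^ 2 = ε ^ 2 ↔
      ‖φ h‖ ^ 2 * θ ^ 2 - 2 * ⟪x, φ h⟫ * θ + (‖x‖ ^ 2 - ε ^ 2) = 0 := by
    rw [norm_sub_sq_real, inner_smul_right, norm_smul, mul_pow, Real.norm_eq_abs, sq_abs,
      ← sub_eq_zero]
    ring_nf
  obtain ⟨hleast, heq⟩ := isLeast_pos_root_quadratic (pow_pos hb 2) ha hc (by positivity) hdisc
  simp only [← hroot] at hleast
  exact ⟨(pow_left_inj₀ (norm_nonneg _) hε.le two_ne_zero).mp hleast.1.2, hleast, heq⟩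
end
end

section
/- For every h ∈ K(ε), the following two relations hold: (i) η(h)·‖φ(h)‖ ≥ ‖x‖ − ε, and (ii) ⟨x − η(h)·φ(h), φ(h)⟩ = ‖φ(h)‖·√(ε² − e(h)). -/
open scoped RealInnerProductSpace

noncomputable section

/- STATEMENT 17: for every `h ∈ K(ε)`, (i) `η(h)‖φ h‖ ≥ ‖x‖ - ε` and
(ii) `⟨x - η(h) φ(h), φ(h)⟩ = ‖φ h‖ √(ε² - e(h))`. -/
theorem stmt17 {H : Type*} [NormedAddCommGroup H] [InnerProductSpace ℝ H]
    [FiniteDimensional ℝ H] {n : ℕ}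
    (φ : H →ₗ[ℝ] EuclideanSpace ℝ (Fin n)) (x : EuclideanSpace ℝ (Fin n))
    (ε : ℝ) (hε : 0 < ε) (hx : ε < ‖x‖) :
    ∀ h ∈ Kcone φ x ε,
      ‖x‖ - ε ≤ etaFun φ x ε h * ‖φ h‖ ∧
      ⟪x - etaFun φ x ε h • φ h, φ h⟫ =
        ‖φ h‖ * Real.sqrt (ε ^ 2 - eFun φ x h) := by
  rintro h ⟨ha, he⟩
  have hy : φ h ≠ 0 := fun h0 => by simp [h0] at ha
  have hp : 0 < ‖φ h‖ := norm_pos_iff.mpr hy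
  have hcs : ⟪x, φ h⟫ ≤ ‖x‖ * ‖φ h‖ := real_inner_le_norm x (φ h)
  have hs0 : 0 ≤ √(ε ^ 2 - eFun φ x h) := Real.sqrt_nonneg _
  have hsq : √(ε ^ 2 - eFun φ x h) ^ 2 = ε ^ 2 - eFun φ x h := Real.sq_sqrt (sub_nonneg.mpr he)
  have hmul : eFun φ x h * ‖φ h‖ ^ 2 = ‖x‖ ^ 2 * ‖φ h‖ ^ 2 - ⟪x, φ h⟫ ^ 2 := by
    rw [eFun, if_neg hy]
    field_simp
  have he0 : 0 ≤ eFun φ x h := by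
    refine nonneg_of_mul_nonneg_left (b := ‖φ h‖ ^ 2) ?_ (by positivity)
    rw [hmul, ← mul_pow]
    exact sub_nonneg.mpr (pow_le_pow_left₀ ha.le hcs 2)
  have hsε : √(ε ^ 2 - eFun φ x h) ≤ ε := Real.sqrt_le_iff.mpr ⟨hε.le, by linarith⟩
  rw [inner_sub_left, real_inner_smul_left, real_inner_self_eq_norm_sq, etaFun]
  generalize √(ε ^ 2 - eFun φ x h) = s at *
  have hd : 0 < ⟪x, φ h⟫ + ‖φ h‖ * s := by positivity
  constructor
  · rw [div_mul_eq_mul_div, le_div_iff₀ hd]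
    have hle : ⟪x, φ h⟫ + ‖φ h‖ * s ≤ (‖x‖ + ε) * ‖φ h‖ := by
      nlinarith [mul_le_mul_of_nonneg_left hsε hp.le]
    calc (‖x‖ - ε) * (⟪x, φ h⟫ + ‖φ h‖ * s)
        ≤ (‖x‖ - ε) * ((‖x‖ + ε) * ‖φ h‖) :=
          mul_le_mul_of_nonneg_left hle (sub_nonneg.mpr hx.le)
      _ = (‖x‖ ^ 2 - ε ^ 2) * ‖φ h‖ := by ring
  · rw [sub_eq_iff_eq_add, ← sub_eq_iff_eq_add', div_mul_eq_mul_div, eq_div_iff hd.ne']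
    linear_combination -‖φ h‖ ^ 2 * hsq + hmul
end
end
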